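/- arXiv:1611.02231 — 2 statements merged into one kernel-verified Lean document; each statement's English description precedes it below -/
import Mathlib

section
/- Let k be an integer with k ≥ 3, let G be a (2k²+k)-edge-connected graph, and let f : V(G) → Z_k be a mapping such that |E(G)| ≡ Σ_{v∈V(G)} f(v) (mod k). Then G has an f-orientation, i.e., an orientation of its edges such that for every vertex v the out-degree d⁺(v) satisfies d⁺(v) ≡ f(v) (mod k). -/
/-- A finite loopless multigraph on vertex type `V` with edge type `E`:
each edge `e` is given by its two (distinct) endpoints `fst e` and `snd e`.
Multiple edges are allowed, loops are not. -/
structure Multigraph (V : Type) (E : Type) where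
  fst : E → V
  snd : E → V
  loopless : ∀ e, fst e ≠ snd e

namespace Multigraph

variable {V E : Type} (G : Multigraph V E)

/-- `u` and `v` are joined by some edge belonging to the edge set `F`. -/
def AdjOn (F : Set E) (u v : V) : Prop :=
  ∃ e ∈ F, (G.fst e = u ∧ G.snd e = v) ∨ (G.fst e = v ∧ G.snd e = u)

/-- The subgraph with vertex set `S` and edge set `F` is a connected spanning
subgraph of the induced subgraph of `G` on `S`: all edges of `F` have both
endpoints in `S`, and any two vertices of `S` are joined by a walk using
edges of `F`. -/
def ConnectedWithin (S : Set V) (F : Set E) : Prop :=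
  (∀ e ∈ F, G.fst e ∈ S ∧ G.snd e ∈ S) ∧
    ∀ u ∈ S, ∀ v ∈ S, Relation.ReflTransGen (G.AdjOn F) u v

/-- The spanning subgraph of `G` with edge set `F` is connected. -/
def ConnectedOn (F : Set E) : Prop := G.ConnectedWithin Set.univ F

/-- `G` is a connected graph. -/
def Connected : Prop := G.ConnectedOn Set.univ

/-- `F` is the edge set of a spanning tree of the induced subgraph of `G`
on `S`, i.e. a minimal edge set making `S` connected. -/
def IsSpanningTreeWithin (S : Set V) (F : Set E) : Prop :=
  G.ConnectedWithin S F ∧ ∀ F' ⊆ F, G.ConnectedWithin S F' → F' = F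

/-- `F` is the edge set of a spanning tree of `G`:
a minimal edge set making `G` connected. -/
def IsSpanningTree (F : Set E) : Prop := G.IsSpanningTreeWithin Set.univ F

/-- `G` contains `t` pairwise edge-disjoint spanning trees. -/
def HasEdgeDisjointSpanningTrees (t : ℕ) : Prop :=
  ∃ T : Fin t → Set E, (∀ i, G.IsSpanningTree (T i)) ∧
    ∀ i j, i ≠ j → Disjoint (T i) (T j)

/-- The edge cut determined by the vertex set `S`: all edges with exactly
one endpoint in `S`. -/
def cutEdges (S : Set V) : Set E :=
  {e | (G.fst e ∈ S ∧ G.snd e ∉ S) ∨ (G.fst e ∉ S ∧ G.snd e ∈ S)}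

/-- `G` is `n`-edge-connected: it is connected and every edge cut has at
least `n` edges. -/
def EdgeConnected (n : ℕ) : Prop :=
  G.Connected ∧
    ∀ S : Set V, S.Nonempty → S ≠ Set.univ → n ≤ (G.cutEdges S).ncard

/-- An orientation of `G` is a map `o : E → Bool`: `o e = true` means `e` is
directed from `fst e` to `snd e`, and `o e = false` means the reverse.
`tail o e` is the initial vertex of `e` under the orientation `o`. -/
def tail (o : E → Bool) (e : E) : V := if o e then G.fst e else G.snd e

/-- The terminal vertex of the edge `e` under the orientation `o`. -/
def head (o : E → Bool) (e : E) : V := if o e then G.snd e else G.fst e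

/-- The number of edges belonging to `F` directed away from `v` by `o`. -/
noncomputable def outDegOn (F : Set E) (o : E → Bool) (v : V) : ℕ :=
  {e ∈ F | G.tail o e = v}.ncard

/-- The out-degree of `v` under the orientation `o`. -/
noncomputable def outDeg (o : E → Bool) (v : V) : ℕ := G.outDegOn Set.univ o v

/-- The in-degree of `v` under the orientation `o`. -/
noncomputable def inDeg (o : E → Bool) (v : V) : ℕ := {e | G.head o e = v}.ncard

/-- The degree of `v` in the spanning subgraph with edge set `F`
(there are no loops, so each edge at `v` counts once). -/
noncomputable def degOn (F : Set E) (v : V) : ℕ := {e ∈ F | G.fst e = v ∨ G.snd e = v}.ncard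

/-- `o` is an `f`-orientation of `G` (modulo `k`): the out-degree of every
vertex `v` is congruent to `f v` modulo `k`. -/
def IsModOrientation (k : ℕ) (f : V → ZMod k) (o : E → Bool) : Prop :=
  ∀ v, (G.outDeg o v : ZMod k) = f v

/-- `G` is `Z_3`-connected: for every `f : V → ZMod 3` with
`|E(G)| ≡ ∑ v, f v (mod 3)`, `G` has an `f`-orientation. -/
def Z3Connected [Fintype V] [Fintype E] : Prop :=
  ∀ f : V → ZMod 3, (Nat.card E : ZMod 3) = ∑ v, f v →
    ∃ o : E → Bool, G.IsModOrientation 3 f o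

/-- `G` is a simple graph: no two distinct edges have the same endpoints
(and there are no loops, by definition of `Multigraph`). -/
def IsSimple : Prop :=
  ∀ e e' : E, s(G.fst e, G.snd e) = s(G.fst e', G.snd e') → e = e'

/-- `G` admits a decomposition of its edge set into stars with `k` edges:
a partition of `E` into parts, each consisting of `k` edges sharing a
common center vertex. -/
def HasStarDecomposition (k : ℕ) : Prop :=
  ∃ P : Set (Set E), (∀ e : E, ∃! p, p ∈ P ∧ e ∈ p) ∧
    ∀ p ∈ P, ∃ c : V, (∀ e ∈ p, G.fst e = c ∨ G.snd e = c) ∧ p.ncard = k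

end Multigraph

/-- A multigraph on `V`, with `m u v` edges joining `u` and `v`, to be oriented. Every vertex `v`
also carries `p v` incoming and `q v` outgoing boundary half-edges, which are already oriented,
and has target out-degree `a v` and target in-degree `b v`. -/
structure Network (V : Type) where
  m : V → V → ℤ
  p : V → ℤ
  q : V → ℤ
  a : V → ℤ
  b : V → ℤ

namespace Network

variable {V : Type} [DecidableEq V] {k : ℤ} {N N' N'' : Network V} {S T A : Finset V}
  {x y z c : V}

/-- The degree of `v` in the network restricted to `S`, boundary half-edges included. -/
def deg (N : Network V) (S : Finset V) (v : V) : ℤ :=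
  ∑ u ∈ S.erase v, N.m v u + N.p v + N.q v

/-- The number of edges of the network on `S` leaving `A`, boundary half-edges included. -/
def cut (N : Network V) (S A : Finset V) : ℤ :=
  ∑ u ∈ A, ∑ v ∈ S \ A, N.m u v + ∑ u ∈ A, (N.p u + N.q u)

/-- The multiplicities make sense and the two targets add up to the degree. -/
structure Valid (N : Network V) (S : Finset V) : Prop where
  symm : ∀ u v, N.m u v = N.m v u
  m_nonneg : ∀ u v, 0 ≤ N.m u v
  p_nonneg : ∀ u, 0 ≤ N.p u
  q_nonneg : ∀ u, 0 ≤ N.q u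
  degree : ∀ v ∈ S, N.a v + N.b v = N.deg S v

/-- The edges inside `S` can be oriented, `x u v` of them from `u` to `v`, so that all out-degrees
agree with the targets modulo `k`. -/
def Solvable (k : ℤ) (N : Network V) (S : Finset V) : Prop :=
  ∃ x : V → V → ℤ, (∀ u v, 0 ≤ x u v) ∧
    (∀ u ∈ S, ∀ v ∈ S, u ≠ v → x u v + x v u = N.m u v) ∧
    ∀ u ∈ S, k ∣ ∑ v ∈ S.erase u, x u v + N.q u - N.a u

/-- The hypotheses under which networks are shown to be solvable. -/
structure Good (k : ℤ) (N : Network V) (S : Finset V) : Prop extends Valid N S where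
  boundary_le : ∑ v ∈ S, (N.p v + N.q v) ≤ 4 * k ^ 2 - 2 * k + 2
  target_ge : 2 ≤ S.card → ∀ v ∈ S, k ^ 2 ≤ N.a v ∧ k ^ 2 ≤ N.b v
  cut_ge : ∀ A ⊆ S, 2 ≤ A.card → A ≠ S → 2 * k ^ 2 + k ≤ N.cut S A
  balance : 2 * k ∣ ∑ v ∈ S, (N.a v - N.b v + N.p v - N.q v)

/-- The adjacency matrix of the star with center `x` and leaves `T`. -/
def star (x : V) (T : Finset V) (u v : V) : ℤ :=
  (if u ∈ T ∧ v = x then 1 else 0) + (if u = x ∧ v ∈ T then 1 else 0)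

lemma star_symm (u v : V) : star x T u v = star x T v u := by
  simp only [star, and_comm]; ring

lemma star_nonneg (u v : V) : 0 ≤ star x T u v := by
  unfold star; positivity

lemma star_of_ne {u v : V} (hu : u ≠ x) (hv : v ≠ x) : star x T u v = 0 := by
  simp [star, hu, hv]

lemma star_center (hx : x ∉ T) (v : V) : star x T x v = if v ∈ T then 1 else 0 := by
  simp [star, hx]

lemma star_le_of_one_le (hs : ∀ u v, N.m u v = N.m v u) (hm : ∀ u v, 0 ≤ N.m u v)
    (hx : x ∉ T) (hT : ∀ y ∈ T, 1 ≤ N.m x y) (u v : V) : star x T u v ≤ N.m u v := by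
  have h0 := hm u v
  unfold star
  split_ifs with h1 h2 h2
  · exact absurd (h2.1 ▸ h1.1) hx
  · obtain ⟨h1, rfl⟩ := h1
    rw [hs]; simpa using hT u h1
  · obtain ⟨rfl, h2⟩ := h2
    simpa using hT v h2
  · simpa using h0

lemma sum_star_row (hx : x ∉ T) (hxS : x ∈ S) (hT : T ⊆ S) (u : V) :
    ∑ v ∈ S.erase u, star x T u v =
      (if u ∈ T then 1 else 0) + (if u = x then (T.card : ℤ) else 0) := by
  unfold star
  rw [Finset.sum_add_distrib]
  congr 1
  · by_cases hu : u ∈ T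
    · have : x ∈ S.erase u := Finset.mem_erase.2 ⟨fun h => hx (h ▸ hu), hxS⟩
      simp only [hu, true_and, if_true, Finset.sum_ite_eq', if_pos this]
    · simp [hu]
  · by_cases hu : u = x
    · subst hu
      have : S.erase u ∩ T = T := by
        ext w; simp only [Finset.mem_inter, Finset.mem_erase]
        exact ⟨fun h => h.2, fun h => ⟨⟨fun e => hx (e ▸ h), hT h⟩, h⟩⟩
      simp [this]
    · simp [hu]

lemma sum_star_cut_le (hx : x ∉ T) : ∑ u ∈ A, ∑ v ∈ S \ A, star x T u v ≤ T.card := by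
  unfold star
  simp only [Finset.sum_add_distrib]
  by_cases hA : x ∈ A
  · have h1 : ∑ u ∈ A, ∑ v ∈ S \ A, (if u ∈ T ∧ v = x then (1 : ℤ) else 0) = 0 := by
      refine Finset.sum_eq_zero fun u _ => Finset.sum_eq_zero fun v hv => if_neg ?_
      rintro ⟨_, rfl⟩
      exact (Finset.mem_sdiff.1 hv).2 hA
    have h2 : ∑ u ∈ A, ∑ v ∈ S \ A, (if u = x ∧ v ∈ T then (1 : ℤ) else 0)
        = ((S \ A) ∩ T).card := by
      rw [Finset.sum_eq_single_of_mem x hA (by intro b _ hb; simp [hb])]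
      simp
    rw [h1, h2, zero_add]
    exact_mod_cast Finset.card_le_card Finset.inter_subset_right
  · have h1 : ∑ u ∈ A, ∑ v ∈ S \ A, (if u = x ∧ v ∈ T then (1 : ℤ) else 0) = 0 := by
      refine Finset.sum_eq_zero fun u hu => Finset.sum_eq_zero fun v _ => if_neg ?_
      rintro ⟨rfl, _⟩
      exact hA hu
    have h2 : ∑ u ∈ A, ∑ v ∈ S \ A, (if u ∈ T ∧ v = x then (1 : ℤ) else 0) ≤
        ∑ u ∈ A, if u ∈ T then 1 else 0 := by
      refine Finset.sum_le_sum fun u _ => ?_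
      by_cases hu : u ∈ T
      · simp only [hu, true_and, if_true, Finset.sum_ite_eq']
        split_ifs <;> norm_num
      · simp [hu]
    have h3 : ∑ u ∈ A, (if u ∈ T then (1 : ℤ) else 0) = (A ∩ T).card := by simp
    rw [h1, add_zero]
    refine h2.trans (h3.le.trans ?_)
    exact_mod_cast Finset.card_le_card Finset.inter_subset_right

lemma exists_split (A : Finset V) (f : V → ℤ) (hf : ∀ w, 0 ≤ f w) :
    ∀ n : ℤ, 0 ≤ n → n ≤ ∑ w ∈ A, f w →
      ∃ g : V → ℤ, (∀ w, 0 ≤ g w ∧ g w ≤ f w) ∧ ∑ w ∈ A, g w = n := by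
  induction A using Finset.induction_on with
  | empty => exact fun n h0 h1 => ⟨fun _ => 0, fun w => ⟨le_rfl, hf w⟩, by simp at *; omega⟩
  | insert i A hi ih =>
    intro n h0 h1
    rw [Finset.sum_insert hi] at h1
    have hfi := hf i
    obtain ⟨g, hg, hs⟩ := ih (n - min n (f i)) (by simp) (by
      rcases min_cases n (f i) with h | h
      · have := Finset.sum_nonneg (fun w (_ : w ∈ A) => hf w); omega
      · omega)
    refine ⟨Function.update g i (min n (f i)), fun w => ?_, ?_⟩
    · by_cases hw : w = i
      · subst hw; simp [h0, hfi]
      · simp [hw, hg w]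
    · rw [Finset.sum_insert hi, Function.update_self]
      rw [Finset.sum_congr rfl (g := g), hs]
      · ring
      · intro w hw
        rw [Function.update_of_ne]; rintro rfl; exact hi hw

lemma Solvable.congr (hm : ∀ u v, N'.m u v = N.m u v)
    (hqa : ∀ u ∈ S, k ∣ (N'.q u - N'.a u) - (N.q u - N.a u)) (h : Solvable k N' S) :
    Solvable k N S := by
  obtain ⟨f, h0, h1, h2⟩ := h
  refine ⟨f, h0, fun u hu v hv huv => (h1 u hu v hv huv).trans (hm u v), fun u hu => ?_⟩
  have h3 := dvd_sub (h2 u hu) (hqa u hu)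
  ring_nf at h3 ⊢
  exact h3

lemma Solvable.of_arrows (hx : x ∉ T) (hxS : x ∈ S)
    (hm : ∀ u v, N'.m u v = N.m u v - star x T u v)
    (hqa : ∀ u ∈ S, k ∣ (N'.q u - N'.a u) - (N.q u - N.a u + if u ∈ T then 1 else 0))
    (h : Solvable k N' S) : Solvable k N S := by
  obtain ⟨f, h0, h1, h2⟩ := h
  refine ⟨fun u v => f u v + if u ∈ T ∧ v = x then 1 else 0, fun u v => ?_,
    fun u hu v hv huv => ?_, fun u hu => ?_⟩
  · have := h0 u v
    positivity
  · have h3 := h1 u hu v hv huv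
    rw [hm] at h3
    simp only [star, and_comm (a := u = x)] at h3
    linarith
  · have h3 : ∑ v ∈ S.erase u, (if u ∈ T ∧ v = x then (1 : ℤ) else 0) =
        if u ∈ T then 1 else 0 := by
      by_cases hu : u ∈ T
      · have : x ∈ S.erase u := Finset.mem_erase.2 ⟨fun h => hx (h ▸ hu), hxS⟩
        simp only [hu, true_and, if_true, Finset.sum_ite_eq', if_pos this]
      · simp [hu]
    rw [Finset.sum_add_distrib, h3]
    have h4 := dvd_sub (h2 u hu) (hqa u hu)
    ring_nf at h4 ⊢
    exact h4

lemma Solvable.of_lift (hxS : x ∈ S) (hy : y ∈ S) (hz : z ∈ S)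
    (hxy : x ≠ y) (hxz : x ≠ z) (hyz : y ≠ z)
    (hm0 : ∀ u v, 0 ≤ N.m u v)
    (hm : ∀ u v, N'.m u v = N.m u v - star x {y, z} u v + star y {z} u v)
    (hq : ∀ u, N'.q u = N.q u) (ha : ∀ u, N'.a u = N.a u - if u = x then 1 else 0)
    (h : Solvable k N' S) : Solvable k N S := by
  obtain ⟨f, h0, h1, h2⟩ := h
  wlog hf : 1 ≤ f y z generalizing y z
  · refine this hz hy hxz hxy hyz.symm (fun u v => ?_) ?_
    · rw [hm, Finset.pair_comm]
      simp only [star, Finset.mem_singleton]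
      ring
    · have h3 := h1 y hy z hz hyz
      have h4 : star x {y, z} y z = 0 := star_of_ne hxy.symm hxz.symm
      have h5 : star y {z} y z = 1 := by simp [star, hyz]
      rw [hm, h4, h5] at h3
      have := hm0 y z
      omega
  refine ⟨fun u v => f u v + (if u = y ∧ v = x then 1 else 0) + (if u = x ∧ v = z then 1 else 0)
      - (if u = y ∧ v = z then 1 else 0), fun u v => ?_, fun u hu v hv huv => ?_, fun u hu => ?_⟩
  · have h3 := h0 u v
    by_cases h4 : u = y ∧ v = z
    · obtain ⟨rfl, rfl⟩ := h4
      simp [hxy.symm, hxz.symm, hf]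
    · simp only [h4, if_false]; split_ifs <;> omega
  · have h3 := h1 u hu v hv huv
    rw [hm] at h3
    have h4 : star x {y, z} u v =
        (if u = y ∧ v = x then 1 else 0) + (if v = y ∧ u = x then 1 else 0)
        + (if u = x ∧ v = z then 1 else 0) + (if v = x ∧ u = z then 1 else 0) := by
      simp only [star, Finset.mem_insert, Finset.mem_singleton]
      grind
    have h5 : star y {z} u v =
        (if u = y ∧ v = z then 1 else 0) + (if v = y ∧ u = z then 1 else 0) := by
      simp only [star, Finset.mem_singleton]
      grind
    linarith
  · have key : ∀ c d : V, c ≠ d → d ∈ S → ∑ v ∈ S.erase u, (if u = c ∧ v = d then (1 : ℤ) else 0) =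
        if u = c then 1 else 0 := by
      intro c d hcd hd
      by_cases hu : u = c
      · have : d ∈ S.erase u := Finset.mem_erase.2 ⟨fun h => hcd (hu ▸ h.symm), hd⟩
        simp only [hu, true_and, if_true, Finset.sum_ite_eq']
        rw [if_pos (hu ▸ this)]
      · simp [hu]
    rw [Finset.sum_sub_distrib, Finset.sum_add_distrib, Finset.sum_add_distrib,
      key y x hxy.symm hxS, key x z hxz hz, key y z hyz hz]
    have h3 := h2 u hu
    rw [hq, ha] at h3
    ring_nf at h3 ⊢
    exact h3

/-- `N'` arises from `N` by splitting off edges at `x`, and solving `N'` suffices to solve `N`. -/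
structure Reduces (k : ℤ) (S : Finset V) (x : V) (N N' : Network V) : Prop where
  valid : Valid N' S
  a_eq : ∀ u, u ≠ x → N'.a u = N.a u
  b_eq : ∀ u, u ≠ x → N'.b u = N.b u
  m_le : ∀ u v, u ≠ x → v ≠ x → N.m u v ≤ N'.m u v
  p_le : ∀ u, u ≠ x → N.p u ≤ N'.p u
  q_le : ∀ u, u ≠ x → N.q u ≤ N'.q u
  sum_p : ∑ v ∈ S, N'.p v = ∑ v ∈ S, N.p v
  sum_q : ∑ v ∈ S, N'.q v = ∑ v ∈ S, N.q v
  solvable : Solvable k N' S → Solvable k N S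

lemma Reduces.refl (h : Valid N S) : Reduces k S x N N :=
  ⟨h, fun _ _ => rfl, fun _ _ => rfl, fun _ _ _ _ => le_rfl, fun _ _ => le_rfl,
    fun _ _ => le_rfl, rfl, rfl, id⟩

lemma Reduces.trans (h : Reduces k S x N N') (h' : Reduces k S x N' N'') :
    Reduces k S x N N'' where
  valid := h'.valid
  a_eq u hu := (h'.a_eq u hu).trans (h.a_eq u hu)
  b_eq u hu := (h'.b_eq u hu).trans (h.b_eq u hu)
  m_le u v hu hv := (h.m_le u v hu hv).trans (h'.m_le u v hu hv)
  p_le u hu := (h.p_le u hu).trans (h'.p_le u hu)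
  q_le u hu := (h.q_le u hu).trans (h'.q_le u hu)
  sum_p := h'.sum_p.trans h.sum_p
  sum_q := h'.sum_q.trans h.sum_q
  solvable := h.solvable ∘ h'.solvable

lemma sum_shift (hx : x ∈ S) (hy : y ∈ S) (f : V → ℤ) (c : ℤ) :
    ∑ u ∈ S, (f u - (if u = x then c else 0) + if u = y then c else 0) = ∑ u ∈ S, f u := by
  simp [Finset.sum_add_distrib, Finset.sum_sub_distrib, hx, hy]

/-- Lift a boundary half-edge at `x` together with an edge `xy` to a half-edge at `y`. -/
lemma exists_boundary_lift (hV : Valid N S) (hx : x ∈ S) (hy : y ∈ S) (hxy : x ≠ y)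
    (hm : 1 ≤ N.m x y) (hpq : 1 ≤ N.p x + N.q x) :
    ∃ N', Reduces k S x N N' ∧ N'.a x = N.a x - 1 ∧ N'.b x = N.b x - 1 ∧
      (∀ A, N.cut S A - 2 ≤ N'.cut S A) ∧ (N'.p x + N'.q x = N.p x + N.q x - 1) ∧
      ∀ v, N'.m x v = N.m x v - if v = y then 1 else 0 := by
  obtain ⟨c, d, hc0, hd0, hcp, hdq, hcd⟩ : ∃ c d : ℤ, 0 ≤ c ∧ 0 ≤ d ∧ c ≤ N.p x ∧ d ≤ N.q x ∧
      c + d = 1 := by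
    have := hV.p_nonneg x
    have := hV.q_nonneg x
    by_cases h : 1 ≤ N.p x
    · exact ⟨1, 0, by omega, by omega, h, this, by omega⟩
    · exact ⟨0, 1, by omega, by omega, by omega, by omega, by omega⟩
  have hxn : x ∉ ({y} : Finset V) := by simpa using hxy
  have hst := star_le_of_one_le hV.symm hV.m_nonneg hxn (by simpa using hm)
  refine ⟨⟨fun u v => N.m u v - star x {y} u v,
    fun u => N.p u - (if u = x then c else 0) + if u = y then c else 0,
    fun u => N.q u - (if u = x then d else 0) + if u = y then d else 0,
    fun u => N.a u - if u = x then 1 else 0, fun u => N.b u - if u = x then 1 else 0⟩,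
    ⟨⟨fun u v => ?_, fun u v => ?_, fun u => ?_, fun u => ?_, fun u hu => ?_⟩,
      fun u hu => ?_, fun u hu => ?_, fun u v hu hv => ?_, fun u hu => ?_, fun u hu => ?_,
      sum_shift hx hy _ _, sum_shift hx hy _ _, fun h => ?_⟩, ?_, ?_, fun A => ?_, ?_, fun v => ?_⟩
  · simp only [hV.symm u v, star_symm u v]
  · exact sub_nonneg.2 (hst u v)
  · have := hV.p_nonneg u
    dsimp only
    split_ifs with h1 h2 <;> (try subst h1) <;> omega
  · have := hV.q_nonneg u
    dsimp only
    split_ifs with h1 h2 <;> (try subst h1) <;> omega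
  · have h1 := hV.degree u hu
    have h2 := sum_star_row hxn hx (Finset.singleton_subset_iff.2 hy) u
    simp only [deg, Finset.sum_sub_distrib, h2, Finset.mem_singleton, Finset.card_singleton] at h1 ⊢
    split_ifs <;> push_cast <;> linarith
  · simp [hu]
  · simp [hu]
  · simp [star_of_ne hu hv]
  · dsimp only; rw [if_neg hu]; split_ifs <;> omega
  · dsimp only; rw [if_neg hu]; split_ifs <;> omega
  · rcases eq_or_ne d 1 with hd | hd
    · refine Solvable.of_arrows hxn hx (fun u v => rfl) (fun u _ => ?_) h
      simp only [hd, Finset.mem_singleton]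
      exact ⟨0, by ring⟩
    · have hd : d = 0 := by omega
      refine Solvable.of_arrows (T := {x}) (x := y) (by simpa using hxy.symm) hy
        (fun u v => ?_) (fun u _ => ?_) h
      · simp only [star, Finset.mem_singleton]; ring
      · simp only [hd, Finset.mem_singleton]
        exact ⟨0, by split_ifs <;> ring⟩
  · simp
  · simp
  · have h1 := sum_star_cut_le (S := S) (A := A) hxn
    simp only [cut, Finset.sum_sub_distrib, Finset.sum_add_distrib, Finset.sum_ite_eq',
      Finset.card_singleton] at h1 ⊢
    split_ifs <;> push_cast at h1 <;> linarith
  · simp [hxy]; linarith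
  · simp [star_center hxn]

/-- Lift the edges `yx` and `xz` to an edge `yz`. -/
lemma exists_interior_lift (hV : Valid N S) (hx : x ∈ S) (hy : y ∈ S) (hz : z ∈ S) (hxy : x ≠ y)
    (hxz : x ≠ z) (hyz : y ≠ z) (hm : 1 ≤ N.m x y) (hm' : 1 ≤ N.m x z) :
    ∃ N', Reduces k S x N N' ∧ N'.a x = N.a x - 1 ∧ N'.b x = N.b x - 1 ∧
      (∀ A, N.cut S A - 2 ≤ N'.cut S A) ∧ (N'.p x + N'.q x = N.p x + N.q x) ∧
      ∀ v, N'.m x v = N.m x v - if v = y ∨ v = z then 1 else 0 := by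
  have hxn : x ∉ ({y, z} : Finset V) := by simp [hxy, hxz]
  have hyn : y ∉ ({z} : Finset V) := by simpa using hyz
  have hst := star_le_of_one_le hV.symm hV.m_nonneg hxn (by simp [hm, hm'])
  refine ⟨⟨fun u v => N.m u v - star x {y, z} u v + star y {z} u v, N.p, N.q,
    fun u => N.a u - if u = x then 1 else 0, fun u => N.b u - if u = x then 1 else 0⟩,
    ⟨⟨fun u v => ?_, fun u v => ?_, hV.p_nonneg, hV.q_nonneg, fun u hu => ?_⟩,
      fun u hu => ?_, fun u hu => ?_, fun u v hu hv => ?_, fun u hu => le_rfl, fun u hu => le_rfl,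
      rfl, rfl, fun h => ?_⟩, ?_, ?_, fun A => ?_, rfl, fun v => ?_⟩
  · simp only [hV.symm u v, star_symm u v]
  · have := hst u v
    have := star_nonneg (x := y) (T := {z}) u v
    dsimp only
    linarith
  · have h1 := hV.degree u hu
    have h2 := sum_star_row hxn hx (S := S) (by simp [Finset.insert_subset_iff, hy, hz]) u
    have h3 := sum_star_row hyn hy (Finset.singleton_subset_iff.2 hz) u
    simp only [deg, Finset.sum_sub_distrib, Finset.sum_add_distrib, h2, h3, Finset.mem_singleton,
      Finset.mem_insert, Finset.card_singleton, Finset.card_pair hyz] at h1 ⊢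
    push_cast
    by_cases e1 : u = x
    · subst e1; simp [hxy, hxz]; linarith
    · by_cases e2 : u = y
      · subst e2; simp [e1, hyz]; linarith
      · by_cases e3 : u = z
        · subst e3; simp [e1, e2]; linarith
        · simp [e1, e2, e3]; linarith
  · simp [hu]
  · simp [hu]
  · simp [star_of_ne hu hv, star_nonneg]
  · refine Solvable.of_lift hx hy hz hxy hxz hyz hV.m_nonneg ?_ ?_ ?_ h <;> intros <;> rfl
  · simp
  · simp
  · have h1 := sum_star_cut_le (S := S) (A := A) hxn
    have h2 : 0 ≤ ∑ u ∈ A, ∑ v ∈ S \ A, star y {z} u v :=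
      Finset.sum_nonneg fun u _ => Finset.sum_nonneg fun v _ => star_nonneg u v
    simp only [cut, Finset.sum_sub_distrib, Finset.sum_add_distrib, Finset.card_pair hyz] at h1 ⊢
    push_cast at h1
    linarith
  · have : star y {z} x v = 0 := by simp [star, hxy, hxz]
    simp only [star_center hxn, this]
    simp

lemma sum_le_sum_erase (hV : Valid N S) (T : Finset V) (hT : T ⊆ S.erase x) :
    ∑ y ∈ T, N.m x y ≤ ∑ y ∈ S.erase x, N.m x y :=
  Finset.sum_le_sum_of_subset_of_nonneg hT fun _ _ _ => hV.m_nonneg _ _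

/-- No neighbour of `x`, the boundary included, receives more than half of the edges at `x`. -/
structure Balanced (N : Network V) (S : Finset V) (x : V) : Prop where
  m_le : ∀ y ∈ S.erase x, 2 * N.m x y ≤ N.a x + N.b x
  pq_le : 2 * (N.p x + N.q x) ≤ N.a x + N.b x

lemma exists_lift (hV : Valid N S) (hx : x ∈ S) (ha : 1 ≤ N.a x) (hb : 1 ≤ N.b x)
    (hbal : Balanced N S x) :
    ∃ N', Reduces k S x N N' ∧ N'.a x = N.a x - 1 ∧ N'.b x = N.b x - 1 ∧
      (∀ A, N.cut S A - 2 ≤ N'.cut S A) ∧ (N.a x = N.b x → Balanced N' S x) := by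
  have hdeg := hV.degree x hx
  unfold deg at hdeg
  have hp := hV.p_nonneg x
  have hq := hV.q_nonneg x
  have hpq := hbal.pq_le
  have hne : (S.erase x).Nonempty := by
    by_contra h
    rw [Finset.not_nonempty_iff_eq_empty] at h
    rw [h, Finset.sum_empty] at hdeg
    omega
  obtain ⟨y, hy, hmax⟩ := Finset.exists_max_image _ (fun y => N.m x y) hne
  have hy1 : 1 ≤ N.m x y := by
    by_contra h
    have : ∑ y ∈ S.erase x, N.m x y ≤ 0 :=
      Finset.sum_nonpos fun v hv => (hmax v hv).trans (by omega)
    omega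
  have hyS := Finset.mem_of_mem_erase hy
  have hxy := (Finset.ne_of_mem_erase hy).symm
  by_cases h : 1 ≤ N.p x + N.q x
  · obtain ⟨N', h1, h2, h3, h4, h5, h6⟩ := exists_boundary_lift (k := k) hV hx hyS hxy hy1 h
    refine ⟨N', h1, h2, h3, h4, fun hab => ⟨fun v hv => ?_, by omega⟩⟩
    have hb1 := hbal.m_le v hv
    rw [h6]
    split_ifs with hvy
    · omega
    · have h7 := sum_le_sum_erase hV {y, v} (Finset.insert_subset hy (Finset.singleton_subset_iff.2 hv))
      rw [Finset.sum_pair (Ne.symm hvy)] at h7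
      have := hmax v hv
      omega
  · obtain ⟨z, hz, hzy, hz1⟩ : ∃ z ∈ S.erase x, z ≠ y ∧ 1 ≤ N.m x z := by
      by_contra! hcon
      have : ∑ v ∈ (S.erase x).erase y, N.m x v ≤ 0 := Finset.sum_nonpos fun v hv => by
        have := hcon v (Finset.mem_of_mem_erase hv) (Finset.ne_of_mem_erase hv)
        omega
      have h7 := Finset.add_sum_erase (S.erase x) (fun v => N.m x v) hy
      have := hbal.m_le y hy
      omega
    obtain ⟨N', h1, h2, h3, h4, h5, h6⟩ := exists_interior_lift (k := k) hV hx hyS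
      (Finset.mem_of_mem_erase hz) hxy (Finset.ne_of_mem_erase hz).symm hzy.symm hy1 hz1
    refine ⟨N', h1, h2, h3, h4, fun hab => ⟨fun v hv => ?_, by omega⟩⟩
    have hb1 := hbal.m_le v hv
    rw [h6]
    split_ifs with hv'
    · omega
    · push Not at hv'
      have h7 := sum_le_sum_erase hV (x := x) {y, z, v}
        (by simp [Finset.insert_subset_iff, hy, hz, hv, -Finset.mem_erase])
      rw [Finset.sum_insert (by simp [hzy.symm, hv'.1.symm]), Finset.sum_pair hv'.2.symm] at h7
      have := hmax v hv
      omega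

/-- Complete splitting of the edges at a balanced vertex. -/
lemma exists_isolate (n : ℕ) : ∀ {N : Network V}, Valid N S → x ∈ S → N.a x = n → N.b x = n →
    Balanced N S x → ∃ N', Reduces k S x N N' ∧ N'.a x = 0 ∧ N'.b x = 0 := by
  induction n with
  | zero => exact fun {N} hV _ ha hb _ => ⟨N, Reduces.refl hV, by simpa using ha, by simpa using hb⟩
  | succ n ih =>
    intro N hV hx ha hb hbal
    push_cast at ha hb
    obtain ⟨N', h1, h2, h3, -, h5⟩ := exists_lift (k := k) hV hx (by omega) (by omega) hbal
    obtain ⟨N'', h6, h7⟩ := ih h1.valid hx (by omega) (by omega) (h5 (by omega))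
    exact ⟨N'', h1.trans h6, h7⟩

lemma Valid.eq_zero_of_isolated (hV : Valid N S) (hx : x ∈ S) (ha : N.a x = 0) (hb : N.b x = 0) :
    N.p x = 0 ∧ N.q x = 0 ∧ ∀ y ∈ S.erase x, N.m x y = 0 := by
  have h := hV.degree x hx
  have h1 := hV.p_nonneg x
  have h2 := hV.q_nonneg x
  have h3 : 0 ≤ ∑ y ∈ S.erase x, N.m x y := Finset.sum_nonneg fun v _ => hV.m_nonneg x v
  unfold deg at h
  refine ⟨by omega, by omega, ?_⟩
  exact (Finset.sum_eq_zero_iff_of_nonneg fun v _ => hV.m_nonneg x v).1 (by omega)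

lemma Valid.erase (hV : Valid N S) (hx : x ∈ S) (ha : N.a x = 0) (hb : N.b x = 0) :
    Valid N (S.erase x) where
  symm := hV.symm
  m_nonneg := hV.m_nonneg
  p_nonneg := hV.p_nonneg
  q_nonneg := hV.q_nonneg
  degree v hv := by
    obtain ⟨-, -, h⟩ := hV.eq_zero_of_isolated hx ha hb
    have hvS := Finset.mem_of_mem_erase hv
    have hxv : x ∈ S.erase v := Finset.mem_erase.2 ⟨(Finset.ne_of_mem_erase hv).symm, hx⟩
    rw [hV.degree v hvS, deg, deg, ← Finset.add_sum_erase _ _ hxv, hV.symm v x, h v hv,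
      Finset.erase_right_comm, zero_add]

lemma Solvable.of_erase (hV : Valid N S) (hx : x ∈ S) (ha : N.a x = 0) (hb : N.b x = 0)
    (h : Solvable k N (S.erase x)) : Solvable k N S := by
  obtain ⟨hp, hq, hm⟩ := hV.eq_zero_of_isolated hx ha hb
  obtain ⟨f, h0, h1, h2⟩ := h
  refine ⟨fun u v => if u = x ∨ v = x then 0 else f u v, fun u v => ?_, fun u hu v hv huv => ?_,
    fun u hu => ?_⟩
  · have := h0 u v
    dsimp only
    split_ifs <;> omega
  · by_cases hux : u = x
    · subst hux; simp [hm v (Finset.mem_erase.2 ⟨huv.symm, hv⟩)]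
    · by_cases hvx : v = x
      · subst hvx; simp [hV.symm u v, hm u (Finset.mem_erase.2 ⟨huv, hu⟩)]
      · simpa [hux, hvx] using
          h1 u (Finset.mem_erase.2 ⟨hux, hu⟩) v (Finset.mem_erase.2 ⟨hvx, hv⟩) huv
  · by_cases hux : u = x
    · subst hux; simp [hq, ha]
    · have h3 := h2 u (Finset.mem_erase.2 ⟨hux, hu⟩)
      have hxu : x ∈ S.erase u := Finset.mem_erase.2 ⟨Ne.symm hux, hx⟩
      rw [← Finset.add_sum_erase _ _ hxu, Finset.erase_right_comm]
      simp only [or_true, if_true, zero_add]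
      rw [Finset.sum_congr rfl (g := fun v => f u v)]
      · exact h3
      · intro v hv
        have : v ≠ x := Finset.ne_of_mem_erase (Finset.mem_of_mem_erase hv)
        simp [hux, this]

lemma dvd_congr {a b c : ℤ} (h : a ∣ b) (e : c = b) : a ∣ c := e ▸ h

lemma cut_singleton : N.cut S {x} = N.deg S x := by
  simp only [cut, deg, Finset.sum_singleton, Finset.sdiff_singleton_eq_erase]
  ring

lemma cut_self : N.cut S S = ∑ u ∈ S, (N.p u + N.q u) := by simp [cut]

lemma two_dvd_sum_sum_erase (f : V → V → ℤ) (hf : ∀ u v, f u v = f v u) (A : Finset V) :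
    2 ∣ ∑ u ∈ A, ∑ v ∈ A.erase u, f u v := by
  induction A using Finset.induction_on with
  | empty => simp
  | insert i A hi ih =>
    have h : ∀ u ∈ A, ∑ v ∈ (insert i A).erase u, f u v = f i u + ∑ v ∈ A.erase u, f u v := by
      intro u hu
      have hiu : i ≠ u := fun h => hi (h ▸ hu)
      rw [Finset.erase_insert_of_ne hiu,
        Finset.sum_insert fun h => hi (Finset.mem_of_mem_erase h), hf u i]
    rw [Finset.sum_insert hi, Finset.erase_insert hi, Finset.sum_congr rfl h,
      Finset.sum_add_distrib, ← add_assoc, ← two_mul]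
    exact dvd_add (dvd_mul_right _ _) ih

lemma sum_deg (hA : A ⊆ S) :
    ∑ u ∈ A, N.deg S u = N.cut S A + ∑ u ∈ A, ∑ v ∈ A.erase u, N.m u v := by
  have h : ∀ u ∈ A, N.deg S u =
      ∑ v ∈ S \ A, N.m u v + (N.p u + N.q u) + ∑ v ∈ A.erase u, N.m u v := by
    intro u hu
    have h1 : S.erase u = (S \ A) ∪ A.erase u := by
      ext w
      simp only [Finset.mem_erase, Finset.mem_union, Finset.mem_sdiff]
      constructor
      · tauto
      · rintro (⟨h, h'⟩ | ⟨h, h'⟩)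
        · exact ⟨fun e => h' (e ▸ hu), h⟩
        · exact ⟨h, hA h'⟩
    rw [deg, h1, Finset.sum_union]
    · ring
    · exact Finset.disjoint_of_subset_right (Finset.erase_subset _ _) Finset.sdiff_disjoint
  rw [Finset.sum_congr rfl h, cut]
  simp only [Finset.sum_add_distrib]

/-- The fibre over `u` of the contraction of `A` to the vertex `c`. -/
def fiber (A : Finset V) (c u : V) : Finset V := if u = c then A else {u}

/-- The network obtained by contracting `A` to `c`, with out-target `α` at `c`. -/
def contract (N : Network V) (S A : Finset V) (c : V) (α : ℤ) : Network V where
  m u v := ∑ i ∈ fiber A c u, ∑ j ∈ fiber A c v, N.m i j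
  p u := ∑ i ∈ fiber A c u, N.p i
  q u := ∑ i ∈ fiber A c u, N.q i
  a u := if u = c then α else N.a u
  b u := if u = c then N.cut S A - α else N.b u

lemma fiber_self : fiber A c c = A := if_pos rfl

lemma fiber_of_ne (h : x ≠ c) : fiber A c x = {x} := if_neg h

lemma mem_fiber_iff {i u : V} (hc : c ∈ A) (hu : u ∈ insert c (S \ A)) :
    i ∈ fiber A c u ↔ u = if i ∈ A then c else i := by
  unfold fiber
  simp only [Finset.mem_insert, Finset.mem_sdiff] at hu
  split_ifs with h1 h2 h2
  · simp [h1, h2]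
  · simp only [h2, false_iff, h1]
    rintro rfl; exact h2 hc
  · simp only [Finset.mem_singleton, h1, iff_false]
    rintro rfl; tauto
  · simp [eq_comm]

lemma pairwiseDisjoint_fiber (hc : c ∈ A) {B : Finset V} (hB : B ⊆ insert c (S \ A)) :
    (B : Set V).PairwiseDisjoint (fiber A c) := by
  intro u hu v hv huv
  refine Finset.disjoint_left.2 fun i hi hi' => huv ?_
  rw [mem_fiber_iff hc (hB hu)] at hi
  rw [mem_fiber_iff hc (hB hv)] at hi'
  rw [hi, hi']

lemma mem_biUnion_fiber_iff {i : V} (hc : c ∈ A) {B : Finset V} (hB : B ⊆ insert c (S \ A)) :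
    i ∈ B.biUnion (fiber A c) ↔ (if i ∈ A then c else i) ∈ B := by
  rw [Finset.mem_biUnion]
  constructor
  · rintro ⟨u, hu, hi⟩
    rwa [← (mem_fiber_iff hc (hB hu)).1 hi]
  · exact fun h => ⟨_, h, (mem_fiber_iff hc (hB h)).2 rfl⟩

lemma biUnion_fiber_sdiff (hA : A ⊆ S) (hc : c ∈ A) {B : Finset V}
    (hB : B ⊆ insert c (S \ A)) :
    (insert c (S \ A) \ B).biUnion (fiber A c) = S \ B.biUnion (fiber A c) := by
  ext i
  rw [mem_biUnion_fiber_iff hc Finset.sdiff_subset, Finset.mem_sdiff, Finset.mem_sdiff,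
    mem_biUnion_fiber_iff hc hB]
  refine and_congr_left fun _ => ?_
  split_ifs with h
  · simp [hA h]
  · simp only [Finset.mem_insert, Finset.mem_sdiff, h, not_false_eq_true, and_true,
      or_iff_right_iff_imp]
    rintro rfl; exact absurd hc h

lemma cut_contract (hA : A ⊆ S) (hc : c ∈ A) (α : ℤ) {B : Finset V}
    (hB : B ⊆ insert c (S \ A)) :
    (N.contract S A c α).cut (insert c (S \ A)) B = N.cut S (B.biUnion (fiber A c)) := by
  unfold cut
  rw [← biUnion_fiber_sdiff hA hc hB, Finset.sum_biUnion (pairwiseDisjoint_fiber hc hB),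
    Finset.sum_biUnion (pairwiseDisjoint_fiber hc hB)]
  simp only [contract, Finset.sum_add_distrib]
  congr 1
  refine Finset.sum_congr rfl fun u _ => ?_
  rw [Finset.sum_comm]
  refine Finset.sum_congr rfl fun i _ => ?_
  rw [Finset.sum_biUnion (pairwiseDisjoint_fiber hc Finset.sdiff_subset)]

lemma deg_contract (hA : A ⊆ S) (hc : c ∈ A) (α : ℤ) {v : V}
    (hv : v ∈ insert c (S \ A)) :
    (N.contract S A c α).deg (insert c (S \ A)) v = N.cut S (fiber A c v) := by
  rw [← cut_singleton, cut_contract hA hc α (Finset.singleton_subset_iff.2 hv),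
    Finset.singleton_biUnion]

lemma Good.contract (hk : 3 ≤ k) (hG : Good k N S) (hA : A ⊆ S) (hA2 : 2 ≤ A.card) (hc : c ∈ A) :
    ∃ α, 2 * k ∣ 2 * α - N.cut S A - ∑ u ∈ A, (N.a u - N.b u) ∧
      Good k (N.contract S A c α) (insert c (S \ A)) := by
  obtain ⟨β, hβ⟩ : 2 ∣ N.cut S A + ∑ u ∈ A, (N.a u - N.b u) := by
    have h1 := sum_deg (N := N) hA
    rw [← Finset.sum_congr rfl fun u hu => hG.degree u (hA hu)] at h1
    obtain ⟨e, he⟩ := two_dvd_sum_sum_erase N.m hG.symm A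
    rw [he] at h1
    simp only [Finset.sum_add_distrib, Finset.sum_sub_distrib] at h1 ⊢
    exact ⟨∑ u ∈ A, N.a u - e, by linarith⟩
  have hlo := Int.emod_nonneg (β - k ^ 2) (show k ≠ 0 by omega)
  have hhi := Int.emod_lt_of_pos (β - k ^ 2) (show 0 < k by omega)
  have hdm := Int.emod_add_mul_ediv (β - k ^ 2) k
  set α := k ^ 2 + (β - k ^ 2) % k with hα
  have hcS : c ∉ S \ A := fun h => (Finset.mem_sdiff.1 h).2 hc
  have hfib : ∀ v ∈ S \ A, fiber A c v = {v} := fun v hv =>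
    fiber_of_ne fun h => hcS (h ▸ hv)
  have hdvd : 2 * k ∣ 2 * α - N.cut S A - ∑ u ∈ A, (N.a u - N.b u) :=
    ⟨-((β - k ^ 2) / k), by linarith⟩
  refine ⟨α, hdvd, ⟨fun u v => ?_, fun u v => ?_, fun u => ?_, fun u => ?_, fun v hv => ?_⟩, ?_,
    fun h2 v hv => ?_, fun B hB hB2 hBS => ?_, ?_⟩
  · simp only [Network.contract]
    rw [Finset.sum_comm]
    simp only [hG.symm]
  · exact Finset.sum_nonneg fun _ _ => Finset.sum_nonneg fun _ _ => hG.m_nonneg _ _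
  · exact Finset.sum_nonneg fun _ _ => hG.p_nonneg _
  · exact Finset.sum_nonneg fun _ _ => hG.q_nonneg _
  · rw [deg_contract hA hc α hv]
    rcases Finset.mem_insert.1 hv with rfl | hv
    · simp [Network.contract, fiber_self]
    · have hvc : v ≠ c := fun h => hcS (h ▸ hv)
      have hvS := (Finset.mem_sdiff.1 hv).1
      rw [hfib v hv, cut_singleton, ← hG.degree v hvS]
      simp [Network.contract, hvc]
  · rw [← cut_self, cut_contract hA hc α subset_rfl]
    have := biUnion_fiber_sdiff hA hc (Finset.empty_subset (insert c (S \ A)))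
    rw [Finset.sdiff_empty] at this
    rw [this, Finset.biUnion_empty, Finset.sdiff_empty, cut_self]
    exact hG.boundary_le
  · rcases Finset.mem_insert.1 hv with rfl | hv
    · have hAS : A ≠ S := by
        rintro rfl
        simp at h2
      have := hG.cut_ge A hA hA2 hAS
      simp only [Network.contract, if_true]
      constructor <;> linarith
    · have hvc : v ≠ c := fun h => hcS (h ▸ hv)
      simp only [Network.contract, hvc, if_false]
      refine hG.target_ge (hA2.trans (Finset.card_le_card hA)) v (Finset.mem_sdiff.1 hv).1
  · rw [cut_contract hA hc α hB]
    refine hG.cut_ge _ ?_ ?_ ?_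
    · intro i hi
      rw [mem_biUnion_fiber_iff hc hB] at hi
      split_ifs at hi with h
      · exact hA h
      · rcases Finset.mem_insert.1 (hB hi) with rfl | h'
        · exact hA hc
        · exact (Finset.mem_sdiff.1 h').1
    · refine hB2.trans (Finset.card_le_card_biUnion (pairwiseDisjoint_fiber hc hB) fun u _ => ?_)
      unfold fiber
      split_ifs
      · exact ⟨c, hc⟩
      · simp
    · intro h
      apply hBS
      refine Finset.Subset.antisymm hB fun v hv => ?_
      have : v ∈ B.biUnion (fiber A c) := by
        rw [h]
        rcases Finset.mem_insert.1 hv with rfl | h'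
        · exact hA hc
        · exact (Finset.mem_sdiff.1 h').1
      rw [mem_biUnion_fiber_iff hc hB] at this
      split_ifs at this with h'
      · rcases Finset.mem_insert.1 hv with rfl | h''
        · exact this
        · exact absurd h' (Finset.mem_sdiff.1 h'').2
      · exact this
  · rw [Finset.sum_insert hcS]
    have h1 : ∀ v ∈ S \ A, (N.contract S A c α).a v - (N.contract S A c α).b v
        + (N.contract S A c α).p v - (N.contract S A c α).q v =
        N.a v - N.b v + N.p v - N.q v := by
      intro v hv
      have hvc : v ≠ c := fun h => hcS (h ▸ hv)
      simp [Network.contract, hvc, hfib v hv]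
    rw [Finset.sum_congr rfl h1]
    have h2 := hG.balance
    rw [← Finset.sum_sdiff hA] at h2
    simp only [Network.contract, if_true, fiber_self]
    refine dvd_congr (dvd_add h2 hdvd) ?_
    simp only [Finset.sum_add_distrib, Finset.sum_sub_distrib]
    ring

/-- Contract `A` to a vertex, solve, and then solve inside `A`. -/
lemma Good.solvable_of_contract (hk : 3 ≤ k) (hG : Good k N S) (hA : A ⊆ S) (hA2 : 2 ≤ A.card)
    (hout : ∀ (S' : Finset V) (N' : Network V), S'.card < S.card → Good k N' S' → Solvable k N' S')
    (hin : ∀ p' q' : V → ℤ, (∀ w, 0 ≤ p' w) → (∀ w, 0 ≤ q' w) →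
      (∀ w ∈ A, p' w + q' w = ∑ u ∈ S \ A, N.m w u + N.p w + N.q w) →
      2 * k ∣ ∑ w ∈ A, (N.a w - N.b w + p' w - q' w) → Solvable k ⟨N.m, p', q', N.a, N.b⟩ A) :
    Solvable k N S := by
  obtain ⟨c, hc⟩ : A.Nonempty := Finset.card_pos.1 (by omega)
  obtain ⟨α, hα, hG'⟩ := hG.contract hk hA hA2 hc
  have hcS : c ∉ S \ A := fun h => (Finset.mem_sdiff.1 h).2 hc
  have hcard : (insert c (S \ A)).card < S.card := by
    have := Finset.card_sdiff_add_card_eq_card hA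
    rw [Finset.card_insert_of_notMem hcS]
    omega
  obtain ⟨f, f0, f1, f2⟩ := hout _ _ hcard hG'
  have hne : ∀ u ∈ S \ A, u ≠ c := fun u hu h => hcS (h ▸ hu)
  have f1c : ∀ u ∈ S \ A, f u c + f c u = ∑ w ∈ A, N.m u w := by
    intro u hu
    rw [f1 u (Finset.mem_insert_of_mem hu) c (Finset.mem_insert_self _ _) (hne u hu)]
    simp [Network.contract, fiber_self, fiber_of_ne (hne u hu)]
  have hsplit : ∀ u, ∃ g : V → ℤ, (∀ w, 0 ≤ g w ∧ g w ≤ N.m u w) ∧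
      (u ∈ S \ A → ∑ w ∈ A, g w = f u c) := by
    intro u
    by_cases hu : u ∈ S \ A
    · obtain ⟨g, hg, hs⟩ := exists_split A (N.m u) (hG.m_nonneg u) (f u c) (f0 u c) (by
        rw [← f1c u hu]; have := f0 c u; omega)
      exact ⟨g, hg, fun _ => hs⟩
    · exact ⟨fun _ => 0, fun w => ⟨le_rfl, hG.m_nonneg u w⟩, fun h => absurd h hu⟩
  choose g hg hgs using hsplit
  have hsol := hin (fun w => N.p w + ∑ u ∈ S \ A, g u w)
    (fun w => N.q w + ∑ u ∈ S \ A, (N.m u w - g u w))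
    (fun w => add_nonneg (hG.p_nonneg w) (Finset.sum_nonneg fun u _ => (hg u w).1))
    (fun w => add_nonneg (hG.q_nonneg w)
      (Finset.sum_nonneg fun u _ => sub_nonneg.2 (hg u w).2)) (fun w _ => by
        simp only [Finset.sum_sub_distrib, hG.symm w]; ring) (by
      have h := f2 c (Finset.mem_insert_self _ _)
      rw [Finset.erase_insert hcS, Finset.sum_congr rfl (g := fun u => ∑ w ∈ A, N.m u w -
        ∑ w ∈ A, g u w) (fun u hu => by rw [← f1c u hu, hgs u hu]; ring)] at h
      simp only [Network.contract, if_true, fiber_self] at h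
      have h2 := mul_dvd_mul_left 2 h
      have h3 := dvd_add hα h2
      rw [← dvd_neg] at h3
      refine dvd_congr h3 ?_
      have h4 : ∑ u ∈ S \ A, ∑ w ∈ A, N.m u w = ∑ w ∈ A, ∑ u ∈ S \ A, N.m w u := by
        rw [Finset.sum_comm]
        simp only [hG.symm]
      have h5 : ∑ w ∈ A, ∑ u ∈ S \ A, N.m u w = ∑ w ∈ A, ∑ u ∈ S \ A, N.m w u := by
        simp only [hG.symm]
      simp only [cut, Finset.sum_add_distrib, Finset.sum_sub_distrib]
      rw [Finset.sum_comm (s := A) (f := fun w u => g u w), h4, h5]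
      ring)
  obtain ⟨e, e0, e1, e2⟩ := hsol
  refine ⟨fun u v => if u ∈ A then (if v ∈ A then e u v else N.m v u - g v u)
    else if v ∈ A then g u v else f u v, fun u v => ?_, fun u hu v hv huv => ?_, fun u hu => ?_⟩
  · have := e0 u v
    have := f0 u v
    have := hg u v
    have := hg v u
    dsimp only
    split_ifs <;> omega
  · by_cases huA : u ∈ A <;> by_cases hvA : v ∈ A <;> simp only [huA, hvA, if_true, if_false]
    · exact e1 u huA v hvA huv
    · rw [hG.symm v u]; ring
    · ring
    · have huS : u ∈ S \ A := Finset.mem_sdiff.2 ⟨hu, huA⟩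
      have hvS : v ∈ S \ A := Finset.mem_sdiff.2 ⟨hv, hvA⟩
      rw [f1 u (Finset.mem_insert_of_mem huS) v (Finset.mem_insert_of_mem hvS) huv]
      simp [Network.contract, fiber_of_ne (hne u huS), fiber_of_ne (hne v hvS)]
  · by_cases huA : u ∈ A <;> simp only [huA, if_true, if_false]
    · have h1 : S.erase u = A.erase u ∪ (S \ A) := by
        ext w
        simp only [Finset.mem_erase, Finset.mem_union, Finset.mem_sdiff]
        constructor
        · tauto
        · rintro (⟨h, h'⟩ | ⟨h, h'⟩)
          · exact ⟨h, hA h'⟩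
          · exact ⟨fun e => h' (e ▸ huA), h⟩
      have h2 := e2 u huA
      rw [h1, Finset.sum_union (Finset.disjoint_of_subset_left (Finset.erase_subset _ _)
        Finset.disjoint_sdiff)]
      rw [Finset.sum_congr rfl (g := e u) fun v hv => if_pos (Finset.mem_of_mem_erase hv),
        Finset.sum_congr rfl (s₁ := S \ A) (g := fun v => N.m v u - g v u)
          fun v hv => if_neg (Finset.mem_sdiff.1 hv).2]
      exact dvd_congr h2 (by ring)
    · have huS : u ∈ S \ A := Finset.mem_sdiff.2 ⟨hu, huA⟩
      have h1 : S.erase u = A ∪ (S \ A).erase u := by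
        ext w
        simp only [Finset.mem_erase, Finset.mem_union, Finset.mem_sdiff]
        constructor
        · tauto
        · rintro (h | ⟨h, h'⟩)
          · exact ⟨fun e => huA (e ▸ h), hA h⟩
          · exact ⟨h, h'.1⟩
      have h2 := f2 u (Finset.mem_insert_of_mem huS)
      rw [h1, Finset.sum_union (Finset.disjoint_of_subset_right (Finset.erase_subset _ _)
        Finset.disjoint_sdiff)]
      rw [Finset.sum_congr rfl (g := g u) fun v hv => if_pos hv,
        Finset.sum_congr rfl (s₁ := (S \ A).erase u) (g := f u)
          fun v hv => if_neg (Finset.mem_sdiff.1 (Finset.mem_of_mem_erase hv)).2, hgs u huS]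
      rw [Finset.erase_insert_of_ne (hne u huS).symm,
        Finset.sum_insert fun h => hcS (Finset.mem_of_mem_erase h)] at h2
      simpa [Network.contract, fiber_of_ne (hne u huS), hne u huS] using h2

/-- The network obtained by reversing all arrows. -/
def flip (N : Network V) : Network V := ⟨N.m, N.q, N.p, N.b, N.a⟩

lemma Valid.flip (h : Valid N S) : Valid N.flip S where
  symm := h.symm
  m_nonneg := h.m_nonneg
  p_nonneg := h.q_nonneg
  q_nonneg := h.p_nonneg
  degree v hv := by
    have := h.degree v hv
    simp only [Network.flip, deg] at this ⊢
    linarith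

lemma cut_flip : N.flip.cut S A = N.cut S A := by
  simp only [Network.flip, cut, add_comm]

lemma Good.flip (h : Good k N S) : Good k N.flip S where
  toValid := h.toValid.flip
  boundary_le := by
    simpa only [Network.flip, add_comm] using h.boundary_le
  target_ge h2 v hv := (h.target_ge h2 v hv).symm
  cut_ge A hA h2 hne := by
    rw [cut_flip]
    exact h.cut_ge A hA h2 hne
  balance := by
    refine dvd_congr ((dvd_neg (a := 2 * k)).2 h.balance) ?_
    rw [← Finset.sum_neg_distrib]
    exact Finset.sum_congr rfl fun v _ => by simp only [Network.flip]; ring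

lemma Solvable.of_flip (hV : Valid N S) (h : Solvable k N.flip S) : Solvable k N S := by
  obtain ⟨f, h0, h1, h2⟩ := h
  refine ⟨fun u v => f v u, fun u v => h0 v u, fun u hu v hv huv => ?_, fun u hu => ?_⟩
  · rw [add_comm]
    exact h1 u hu v hv huv
  · refine dvd_congr ((dvd_neg (a := k)).2 (h2 u hu)) ?_
    have h3 := hV.degree u hu
    have h4 : ∑ v ∈ S.erase u, (f u v + f v u) = ∑ v ∈ S.erase u, N.m u v :=
      Finset.sum_congr rfl fun v hv =>
        h1 u hu v (Finset.mem_of_mem_erase hv) (Finset.ne_of_mem_erase hv).symm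
    rw [Finset.sum_add_distrib] at h4
    simp only [Network.flip, deg] at h3 ⊢
    linarith

lemma Good.solvable_of_card_le_one (hG : Good k N S) (hS : S.card ≤ 1) : Solvable k N S := by
  rcases S.eq_empty_or_nonempty with rfl | ⟨x, hx⟩
  · exact ⟨fun _ _ => 0, by simp, by simp, by simp⟩
  · obtain rfl : S = {x} := Finset.eq_singleton_iff_unique_mem.2
      ⟨hx, fun y hy => Finset.card_le_one.1 hS y hy x hx⟩
    refine ⟨fun _ _ => 0, by simp, fun u hu v hv huv => ?_, fun u hu => ?_⟩
    · rw [Finset.mem_singleton] at hu hv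
      exact absurd (hu.trans hv.symm) huv
    · obtain rfl := Finset.mem_singleton.1 hu
      have h1 := hG.degree u hu
      have h2 := hG.balance
      simp only [Finset.sum_singleton, deg, Finset.erase_singleton, Finset.sum_empty] at h1 h2 ⊢
      refine (mul_dvd_mul_iff_left (two_ne_zero (α := ℤ))).1
        (dvd_congr ((dvd_neg (a := 2 * k)).2 h2) (by linarith))

lemma Good.solvable_of_cut_le (hk : 3 ≤ k) (hG : Good k N S) (hA : A ⊆ S) (hA2 : 2 ≤ A.card)
    (hne : A ≠ S) (hcut : N.cut S A ≤ 4 * k ^ 2 - 2 * k + 2)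
    (ih : ∀ (S' : Finset V) (N' : Network V), S'.card < S.card → Good k N' S' → Solvable k N' S') :
    Solvable k N S := by
  refine hG.solvable_of_contract hk hA hA2 ih fun p' q' hp hq hpq hbal => ?_
  have hcutB : ∀ B ⊆ A, (⟨N.m, p', q', N.a, N.b⟩ : Network V).cut A B = N.cut S B := by
    intro B hB
    have h1 : S \ B = (A \ B) ∪ (S \ A) := by
      ext w
      have := @hA w
      have := @hB w
      simp only [Finset.mem_sdiff, Finset.mem_union]
      tauto
    have h2 : Disjoint (A \ B) (S \ A) :=
      Finset.disjoint_of_subset_left Finset.sdiff_subset Finset.disjoint_sdiff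
    simp only [cut]
    rw [h1, Finset.sum_congr rfl (s₁ := B) fun w hw => hpq w (hB hw)]
    simp only [Finset.sum_union h2, Finset.sum_add_distrib]
    ring
  refine ih A _ (Finset.card_lt_card (hA.ssubset_of_ne hne))
    ⟨⟨hG.symm, hG.m_nonneg, hp, hq, fun v hv => ?_⟩, ?_, fun _ v hv => ?_, fun B hB hB2 hBA => ?_,
      hbal⟩
  · rw [← cut_singleton, hcutB _ (Finset.singleton_subset_iff.2 hv), cut_singleton]
    exact hG.degree v (hA hv)
  · have h := hcutB A subset_rfl
    rw [cut_self] at h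
    exact h.le.trans hcut
  · exact hG.target_ge (hA2.trans (Finset.card_le_card hA)) v (hA hv)
  · rw [hcutB B hB]
    refine hG.cut_ge B (hB.trans hA) hB2 fun h => hBA ?_
    exact hB.antisymm (h ▸ hA)

lemma Good.solvable_of_le_m (hk : 3 ≤ k) (hG : Good k N S) (hx : x ∈ S) (hy : y ∈ S) (hxy : x ≠ y)
    (hm : k - 1 ≤ N.m x y)
    (ih : ∀ (S' : Finset V) (N' : Network V), S'.card < S.card → Good k N' S' → Solvable k N' S') :
    Solvable k N S := by
  refine hG.solvable_of_contract hk (A := {x, y}) (by simp [Finset.insert_subset_iff, hx, hy])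
    (Finset.card_pair hxy).ge ih fun p' q' hp hq hpq hbal => ?_
  have hex : ({x, y} : Finset V).erase x = {y} := by
    rw [Finset.erase_insert (by simpa using hxy)]
  have hey : ({x, y} : Finset V).erase y = {x} := by
    rw [Finset.pair_comm, Finset.erase_insert (by simpa using hxy.symm)]
  have hsdiff : ∀ u ∈ ({x, y} : Finset V),
      ∑ v ∈ S.erase u, N.m u v = ∑ v ∈ ({x, y} : Finset V).erase u, N.m u v +
        ∑ v ∈ S \ {x, y}, N.m u v := by
    intro u hu
    rw [← Finset.sum_union]
    · congr 1
      ext w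
      simp only [Finset.mem_erase, Finset.mem_union, Finset.mem_sdiff, Finset.mem_insert,
        Finset.mem_singleton] at hu ⊢
      grind
    · exact Finset.disjoint_of_subset_left (Finset.erase_subset _ _) Finset.disjoint_sdiff
  have hdx := hG.degree x hx
  have hdy := hG.degree y hy
  have hpx := hpq x (by simp)
  have hpy := hpq y (by simp)
  rw [deg, hsdiff x (by simp), hex, Finset.sum_singleton] at hdx
  rw [deg, hsdiff y (by simp), hey, Finset.sum_singleton, hG.symm] at hdy
  rw [Finset.sum_pair hxy] at hbal
  set e := (N.a x - q' x) % k with he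
  have he0 : 0 ≤ e := Int.emod_nonneg _ (by omega)
  have he1 : e < k := Int.emod_lt_of_pos _ (by omega)
  have hdm := Int.emod_add_mul_ediv (N.a x - q' x) k
  obtain ⟨d, hd⟩ := hbal
  refine ⟨fun u v => if u = x then e else if u = y then N.m x y - e else 0, fun u v => ?_,
    fun u hu v hv huv => ?_, fun u hu => ?_⟩
  · dsimp only
    split_ifs <;> omega
  · simp only [Finset.mem_insert, Finset.mem_singleton] at hu hv
    have := hG.symm x y
    rcases hu with rfl | rfl <;> rcases hv with rfl | rfl
    · exact absurd rfl huv
    · simp [hxy.symm]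
    · simp [hxy.symm, this]
    · exact absurd rfl huv
  · simp only [Finset.mem_insert, Finset.mem_singleton] at hu
    rcases hu with rfl | rfl
    · rw [hex]
      simp only [Finset.sum_singleton, if_true]
      exact ⟨-((N.a u - q' u) / k), by linarith⟩
    · rw [hey]
      simp only [Finset.sum_singleton, if_true, hxy.symm, if_false]
      refine ⟨(N.a x - q' x) / k - d, ?_⟩
      have : 2 * (N.m x u - e + q' u - N.a u) = 2 * (k * ((N.a x - q' x) / k - d)) := by
        linarith
      linarith

/-- A network in which no contraction is available. -/
structure Tight (k : ℤ) (N : Network V) (S : Finset V) : Prop extends Good k N S where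
  two_le_card : 2 ≤ S.card
  lt_cut : ∀ A ⊆ S, 2 ≤ A.card → A ≠ S → 4 * k ^ 2 - 2 * k + 3 ≤ N.cut S A
  m_le : ∀ u ∈ S, ∀ v ∈ S, u ≠ v → N.m u v ≤ k - 2

/-- There is a solvability-reflecting reduction to a smaller network on the same vertices. -/
def Improvable (k : ℤ) (N : Network V) (S : Finset V) : Prop :=
  ∃ N', Good k N' S ∧ ∑ v ∈ S, (N'.a v + N'.b v) < ∑ v ∈ S, (N.a v + N.b v) ∧
    (Solvable k N' S → Solvable k N S)

lemma Tight.flip (h : Tight k N S) : Tight k N.flip S where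
  toGood := h.toGood.flip
  two_le_card := h.two_le_card
  lt_cut A hA h2 hne := by
    rw [cut_flip]
    exact h.lt_cut A hA h2 hne
  m_le := h.m_le

lemma Improvable.of_flip (hV : Valid N S) (h : Improvable k N.flip S) : Improvable k N S := by
  obtain ⟨N', h1, h2, h3⟩ := h
  refine ⟨N', h1, ?_, fun h => (h3 h).of_flip hV⟩
  simpa only [Network.flip, add_comm (N.b _)] using h2

lemma Tight.three_le_card (h : Tight k N S) : 3 ≤ S.card := by
  by_contra hcard
  obtain ⟨x, y, hxy, rfl⟩ := Finset.card_eq_two.1 (show S.card = 2 by have := h.two_le_card; omega)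
  have h1 := sum_deg (N := N) (subset_refl ({x, y} : Finset V))
  rw [← Finset.sum_congr rfl fun u hu => h.degree u hu, cut_self] at h1
  have h2 := h.boundary_le
  have h3 := h.target_ge h.two_le_card x (by simp)
  have h4 := h.target_ge h.two_le_card y (by simp)
  have hex : ({x, y} : Finset V).erase x = {y} := by
    rw [Finset.erase_insert (by simpa using hxy)]
  have hey : ({x, y} : Finset V).erase y = {x} := by
    rw [Finset.pair_comm, Finset.erase_insert (by simpa using hxy.symm)]
  rw [Finset.sum_pair hxy, Finset.sum_pair hxy (f := fun u => ∑ v ∈ _, N.m u v), hex, hey] at h1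
  simp only [Finset.sum_singleton] at h1
  have h5 := h.m_le x (by simp) y (by simp) hxy
  rw [h.symm y x] at h1
  linarith

lemma sdiff_erase_self (hx : x ∈ S) : S \ S.erase x = {x} := by
  rw [Finset.sdiff_erase hx, Finset.sdiff_self, Finset.insert_empty]

lemma Tight.boundary_lt (h : Tight k N S) (hx : x ∈ S) :
    2 * (N.p x + N.q x) < N.a x + N.b x := by
  have h3 := h.three_le_card
  have h1 := h.lt_cut (S.erase x) (Finset.erase_subset _ _)
    (by rw [Finset.card_erase_of_mem hx]; omega)
    (fun e => Finset.notMem_erase x S (by rw [e]; exact hx))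
  have h2 := h.boundary_le
  have h4 := h.degree x hx
  rw [← Finset.add_sum_erase S _ hx] at h2
  rw [cut, sdiff_erase_self hx] at h1
  simp only [Finset.sum_singleton] at h1
  rw [deg, Finset.sum_congr rfl fun u _ => h.symm x u] at h4
  linarith

lemma Tight.balanced (hk : 3 ≤ k) (h : Tight k N S) (hx : x ∈ S) : Balanced N S x where
  m_le y hy := by
    have h1 := h.m_le x hx y (Finset.mem_of_mem_erase hy) (Finset.ne_of_mem_erase hy).symm
    have h2 := h.target_ge h.two_le_card x hx
    nlinarith
  pq_le := (h.boundary_lt hx).le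

lemma Tight.improvable_of_lt (hk : 3 ≤ k) (h : Tight k N S) (hx : x ∈ S) (ha : k ^ 2 < N.a x)
    (hb : k ^ 2 < N.b x) : Improvable k N S := by
  have hk2 : 0 ≤ k ^ 2 := sq_nonneg k
  obtain ⟨N', h1, h2, h3, h4, -⟩ :=
    exists_lift (k := k) h.toValid hx (by omega) (by omega) (h.balanced hk hx)
  have hab : ∀ v, N'.a v - N'.b v = N.a v - N.b v := fun v => by
    by_cases hv : v = x
    · rw [hv, h2, h3]; ring
    · rw [h1.a_eq v hv, h1.b_eq v hv]
  refine ⟨N', ⟨h1.valid, ?_, fun hS v hv => ?_, fun A hA hA2 hne => ?_, ?_⟩, ?_, h1.solvable⟩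
  · rw [Finset.sum_add_distrib, h1.sum_p, h1.sum_q, ← Finset.sum_add_distrib]
    exact h.boundary_le
  · by_cases hvx : v = x
    · rw [hvx, h2, h3]; omega
    · rw [h1.a_eq v hvx, h1.b_eq v hvx]
      exact h.target_ge hS v hv
  · have := h.lt_cut A hA hA2 hne
    have := h4 A
    nlinarith
  · refine dvd_congr h.balance ?_
    simp only [hab, Finset.sum_add_distrib, Finset.sum_sub_distrib, h1.sum_p, h1.sum_q]
  · refine Finset.sum_lt_sum (fun v _ => ?_) ⟨x, hx, by omega⟩
    by_cases hvx : v = x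
    · rw [hvx, h2, h3]; omega
    · rw [h1.a_eq v hvx, h1.b_eq v hvx]

lemma Tight.improvable_of_large (hk : 3 ≤ k) (h : Tight k N S) (hx : x ∈ S)
    (ha : k ^ 2 + k < N.a x) : Improvable k N S := by
  have hb := (h.target_ge h.two_le_card x hx).2
  have hT : Tight k ⟨N.m, N.p, N.q, fun u => N.a u - if u = x then k else 0,
      fun u => N.b u + if u = x then k else 0⟩ S := by
    refine ⟨⟨⟨h.symm, h.m_nonneg, h.p_nonneg, h.q_nonneg, fun v hv => ?_⟩, h.boundary_le,
      fun hS v hv => ?_, h.cut_ge, ?_⟩, h.two_le_card, h.lt_cut, h.m_le⟩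
    · have := h.degree v hv
      simp only [deg] at this ⊢
      linarith
    · have := h.target_ge hS v hv
      dsimp only
      split_ifs with e
      · subst e; omega
      · omega
    · refine dvd_congr (dvd_sub h.balance (dvd_refl (2 * k))) ?_
      simp only [Finset.sum_add_distrib, Finset.sum_sub_distrib, Finset.sum_ite_eq', hx, if_true]
      ring
  obtain ⟨N', h1, h2, h3⟩ := hT.improvable_of_lt hk hx (by simp; omega) (by simp; omega)
  refine ⟨N', h1, ?_, fun hs => (h3 hs).congr (by simp) (fun u _ => ?_)⟩
  · simpa only [sub_add_add_cancel] using h2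
  · dsimp only
    split_ifs
    · exact ⟨1, by ring⟩
    · exact ⟨0, by ring⟩

/-- Delete an edge directed from `x` to `y`. -/
lemma Tight.improvable_of_edge (hk : 3 ≤ k) (h : Tight k N S) (hx : x ∈ S) (hy : y ∈ S)
    (hxy : x ≠ y) (hm : 1 ≤ N.m x y) (ha : k ^ 2 < N.a x) (hb : k ^ 2 < N.b y) :
    Improvable k N S := by
  have hyn : y ∉ ({x} : Finset V) := by simpa using hxy.symm
  have hst := star_le_of_one_le h.symm h.m_nonneg hyn (by simpa [h.symm y x] using hm)
  refine ⟨⟨fun u v => N.m u v - star y {x} u v, N.p, N.q,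
    fun u => N.a u - if u = x then 1 else 0, fun u => N.b u - if u = y then 1 else 0⟩,
    ⟨⟨fun u v => ?_, fun u v => sub_nonneg.2 (hst u v), h.p_nonneg, h.q_nonneg, fun u hu => ?_⟩,
      h.boundary_le, fun hS v hv => ?_, fun A hA hA2 hne => ?_, ?_⟩, ?_, fun hs => ?_⟩
  · simp only [h.symm u v, star_symm u v]
  · have h1 := h.degree u hu
    have h2 := sum_star_row hyn hy (Finset.singleton_subset_iff.2 hx) u
    simp only [deg, Finset.sum_sub_distrib, h2, Finset.mem_singleton, Finset.card_singleton,
      Nat.cast_one] at h1 ⊢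
    linarith
  · have := h.target_ge hS v hv
    dsimp only
    constructor <;> split_ifs with e <;> (try subst e) <;> omega
  · have h1 := sum_star_cut_le (S := S) (A := A) hyn
    have h2 := h.lt_cut A hA hA2 hne
    simp only [cut, Finset.sum_sub_distrib, Finset.card_singleton, Nat.cast_one] at h1 h2 ⊢
    nlinarith
  · refine dvd_congr h.balance ?_
    simp only [Finset.sum_add_distrib, Finset.sum_sub_distrib, Finset.sum_ite_eq', hx, hy, if_true]
    ring
  · simp only [Finset.sum_add_distrib, Finset.sum_sub_distrib, Finset.sum_ite_eq', hx, hy, if_true]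
    linarith
  · refine Solvable.of_arrows hyn hy (fun _ _ => rfl) (fun u _ => ⟨0, ?_⟩) hs
    simp only [Finset.mem_singleton]
    ring

/-- Delete a half-edge leaving `x`. -/
lemma Tight.improvable_of_half_edge (hk : 3 ≤ k) (h : Tight k N S) (hx : x ∈ S)
    (ha : k ^ 2 < N.a x) (hq : 1 ≤ N.q x) : Improvable k N S := by
  refine ⟨⟨N.m, N.p, fun u => N.q u - if u = x then 1 else 0,
    fun u => N.a u - if u = x then 1 else 0, N.b⟩,
    ⟨⟨h.symm, h.m_nonneg, h.p_nonneg, fun u => ?_, fun u hu => ?_⟩,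
      ?_, fun hS v hv => ?_, fun A hA hA2 hne => ?_, ?_⟩, ?_, fun hs => ?_⟩
  · have := h.q_nonneg u
    dsimp only
    split_ifs with e <;> (try subst e) <;> omega
  · have h1 := h.degree u hu
    simp only [deg] at h1 ⊢
    linarith
  · have := h.boundary_le
    simp only [Finset.sum_add_distrib, Finset.sum_sub_distrib, Finset.sum_ite_eq', hx,
      if_true] at this ⊢
    linarith
  · have := h.target_ge hS v hv
    dsimp only
    split_ifs with e <;> (try subst e) <;> omega
  · have h2 := h.lt_cut A hA hA2 hne
    simp only [cut, Finset.sum_add_distrib, Finset.sum_sub_distrib, Finset.sum_ite_eq'] at h2 ⊢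
    split_ifs <;> nlinarith
  · refine dvd_congr h.balance ?_
    simp only [Finset.sum_add_distrib, Finset.sum_sub_distrib]
    ring
  · simp only [Finset.sum_add_distrib, Finset.sum_sub_distrib, Finset.sum_ite_eq', hx, if_true]
    linarith
  · exact hs.congr (by simp) fun u _ => ⟨0, by ring⟩

/-- Split off all edges at `x` in a modification `N'` of `N` at `x`, and delete `x`. -/
lemma Tight.solvable_of_isolate (hk : 3 ≤ k) (h : Tight k N S) (hx : x ∈ S)
    (hdeg : N.a x + N.b x ≤ 2 * k ^ 2 + k) (hV : Valid N' S) (hab : N'.a x = N'.b x)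
    (hbal : Balanced N' S x)
    (hm : ∀ u v, u ≠ x → v ≠ x → N'.m u v = N.m u v) (hp : ∀ u, u ≠ x → N'.p u = N.p u)
    (hq : ∀ u, u ≠ x → N'.q u = N.q u)
    (ht : ∀ u ∈ S, u ≠ x → k ^ 2 ≤ N'.a u ∧ k ^ 2 ≤ N'.b u)
    (hbd : ∑ v ∈ S, (N'.p v + N'.q v) ≤ 4 * k ^ 2 - 2 * k + 2)
    (hdvd : 2 * k ∣ ∑ v ∈ S, (N'.a v - N'.b v + N'.p v - N'.q v))
    (ih : ∀ (S' : Finset V) (N' : Network V), S'.card < S.card → Good k N' S' → Solvable k N' S') :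
    Solvable k N' S := by
  have h0 : 0 ≤ N'.a x := by
    have h1 := hV.degree x hx
    have h2 := hV.p_nonneg x
    have h3 := hV.q_nonneg x
    have h4 : 0 ≤ ∑ u ∈ S.erase x, N'.m x u := Finset.sum_nonneg fun u _ => hV.m_nonneg x u
    unfold deg at h1
    omega
  obtain ⟨n, hn⟩ := Int.eq_ofNat_of_zero_le h0
  obtain ⟨N₁, h1, h2, h3⟩ := exists_isolate (k := k) n hV hx hn (hab ▸ hn) hbal
  refine h1.solvable (Solvable.of_erase h1.valid hx h2 h3 (ih _ _ ?_ ⟨h1.valid.erase hx h2 h3,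
    ?_, fun _ v hv => ?_, fun A hA hA2 hne => ?_, ?_⟩))
  · exact Finset.card_erase_lt_of_mem hx
  · refine le_trans ?_ hbd
    rw [Finset.sum_add_distrib (s := S), ← h1.sum_p, ← h1.sum_q, ← Finset.sum_add_distrib]
    exact Finset.sum_le_sum_of_subset_of_nonneg (Finset.erase_subset _ _)
      fun u _ _ => add_nonneg (h1.valid.p_nonneg u) (h1.valid.q_nonneg u)
  · have hvx := Finset.ne_of_mem_erase hv
    rw [h1.a_eq v hvx, h1.b_eq v hvx]
    exact ht v (Finset.mem_of_mem_erase hv) hvx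
  · have hxA : x ∉ A := fun hxA => Finset.notMem_erase x S (hA hxA)
    have hAS : A ⊆ S := hA.trans (Finset.erase_subset _ _)
    have hxB : x ∉ S.erase x \ A := fun hxB => Finset.notMem_erase x S (Finset.mem_sdiff.1 hxB).1
    have hle : N.cut (S.erase x) A ≤ N₁.cut (S.erase x) A := by
      unfold cut
      refine add_le_add (Finset.sum_le_sum fun u hu => Finset.sum_le_sum fun v hv => ?_)
        (Finset.sum_le_sum fun u hu => ?_)
      · have hux : u ≠ x := fun e => hxA (e ▸ hu)
        have hvx : v ≠ x := fun e => hxB (e ▸ hv)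
        rw [← hm u v hux hvx]
        exact h1.m_le u v hux hvx
      · have hux : u ≠ x := fun e => hxA (e ▸ hu)
        have h4 := h1.p_le u hux
        have h5 := h1.q_le u hux
        rw [hp u hux] at h4
        rw [hq u hux] at h5
        omega
    have e1 : S \ A = insert x (S.erase x \ A) := by
      ext w
      simp only [Finset.mem_sdiff, Finset.mem_insert, Finset.mem_erase]
      grind
    have e2 : S \ insert x A = S.erase x \ A := by
      ext w
      simp only [Finset.mem_sdiff, Finset.mem_insert, Finset.mem_erase]
      tauto
    have e3 : S.erase x = A ∪ (S.erase x \ A) := (Finset.union_sdiff_of_subset hA).symm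
    have c1 := h.lt_cut A hAS hA2 fun e => hxA (e ▸ hx)
    have c2 := h.lt_cut (insert x A) (Finset.insert_subset hx hAS)
      (hA2.trans (Finset.card_le_card (Finset.subset_insert _ _))) fun e => hne (by
        rw [← e, Finset.erase_insert hxA])
    have hd := h.degree x hx
    rw [deg, e3, Finset.sum_union Finset.disjoint_sdiff] at hd
    rw [cut, e1] at c1
    rw [cut, e2, Finset.sum_insert hxA, Finset.sum_insert hxA] at c2
    simp only [Finset.sum_insert hxB, Finset.sum_add_distrib] at c1 c2
    rw [Finset.sum_congr rfl fun u _ => h.symm u x] at c1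
    have hc : N.cut (S.erase x) A = ∑ u ∈ A, ∑ v ∈ S.erase x \ A, N.m u v +
        (∑ u ∈ A, N.p u + ∑ u ∈ A, N.q u) := by
      rw [cut, Finset.sum_add_distrib]
    nlinarith
  · obtain ⟨hp0, hq0, -⟩ := h1.valid.eq_zero_of_isolated hx h2 h3
    refine dvd_congr hdvd ?_
    have e : ∀ v, N₁.a v - N₁.b v = N'.a v - N'.b v := fun v => by
      by_cases hv : v = x
      · rw [hv, h2, h3, hab]; ring
      · rw [h1.a_eq v hv, h1.b_eq v hv]
    have e' := Finset.add_sum_erase S (fun v => N₁.a v - N₁.b v + N₁.p v - N₁.q v) hx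
    simp only [h2, h3, hp0, hq0, sub_zero, add_zero, zero_add] at e'
    rw [e']
    simp only [e, Finset.sum_sub_distrib, Finset.sum_add_distrib, h1.sum_p, h1.sum_q]

/-- If `b x = k ^ 2 < a x` and every neighbour `y` of `x` has `k ^ 2 < a y`, then enough edges can
be directed into `x` to replace `a x` by `a x - k`, after which the rest is split off. -/
lemma Tight.solvable_of_source (hk : 3 ≤ k) (h : Tight k N S) (hx : x ∈ S)
    (ha : k ^ 2 < N.a x) (ha' : N.a x ≤ k ^ 2 + k) (hb : N.b x = k ^ 2) (hq : N.q x = 0)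
    (hnb : ∀ y ∈ S, x ≠ y → 1 ≤ N.m x y → k ^ 2 < N.a y)
    (ih : ∀ (S' : Finset V) (N' : Network V), S'.card < S.card → Good k N' S' → Solvable k N' S') :
    Solvable k N S := by
  obtain ⟨t, ht⟩ : ∃ t, t = N.a x - k ^ 2 := ⟨_, rfl⟩
  obtain ⟨j, hj⟩ : ∃ j, j = min (N.p x) (2 * k - t) := ⟨_, rfl⟩
  have hpx := h.p_nonneg x
  have hd := h.degree x hx
  have hbl := h.boundary_lt hx
  unfold deg at hd
  have hj0 : 0 ≤ j := by omega
  have hT : ∃ T ⊆ (S.erase x).filter (fun y => 1 ≤ N.m x y), (T.card : ℤ) = 2 * k - t - j := by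
    have hcard : 2 * k - t - j ≤ ((S.erase x).filter (fun y => 1 ≤ N.m x y)).card := by
      have h1 : ∑ y ∈ S.erase x, N.m x y ≤
          ((S.erase x).filter (fun y => 1 ≤ N.m x y)).card * (k - 2) := by
        rw [← nsmul_eq_mul, ← Finset.sum_const, Finset.sum_filter]
        refine Finset.sum_le_sum fun y hy => ?_
        have := h.m_le x hx y (Finset.mem_of_mem_erase hy) (Finset.ne_of_mem_erase hy).symm
        split_ifs <;> omega
      rcases le_total (2 * k - t) (N.p x) with h2 | h2
      · rw [min_eq_right h2] at hj
        have := Int.natCast_nonneg ((S.erase x).filter (fun y => 1 ≤ N.m x y)).card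
        omega
      · rw [min_eq_left h2] at hj
        by_contra! hlt
        have h3 : (((S.erase x).filter (fun y => 1 ≤ N.m x y)).card : ℤ) * (k - 2) ≤
            (2 * k - t - j - 1) * (k - 2) :=
          mul_le_mul_of_nonneg_right (by omega) (by omega)
        have h4 : 0 ≤ (k - 3) * N.p x := mul_nonneg (by omega) hpx
        have h5 : 0 ≤ (k - 2) * (t + 1) := mul_nonneg (by omega) (by omega)
        rw [hj] at h3
        nlinarith
    obtain ⟨T, hT, hT'⟩ := Finset.exists_subset_card_eq
      (s := (S.erase x).filter (fun y => 1 ≤ N.m x y)) (n := (2 * k - t - j).toNat) (by omega)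
    exact ⟨T, hT, by omega⟩
  obtain ⟨T, hTs, hTc⟩ := hT
  have hTm : ∀ y ∈ T, y ∈ S ∧ x ≠ y ∧ 1 ≤ N.m x y := fun y hy => by
    have := hTs hy
    simp only [Finset.mem_filter, Finset.mem_erase] at this
    exact ⟨this.1.2, this.1.1.symm, this.2⟩
  have hxT : x ∉ T := fun e => (hTm x e).2.1 rfl
  have hTS : T ⊆ S := fun y hy => (hTm y hy).1
  have hst := star_le_of_one_le h.symm h.m_nonneg hxT fun y hy => (hTm y hy).2.2
  have hcT : ∑ v ∈ S, (if v ∈ T then (1 : ℤ) else 0) = 2 * k - t - j := by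
    rw [← hTc, Finset.sum_ite_mem, Finset.inter_eq_right.2 hTS]
    simp
  have hs : Solvable k ⟨fun u v => N.m u v - star x T u v, fun u => N.p u - if u = x then j else 0,
      N.q, fun u => N.a u - (if u ∈ T then 1 else 0) - if u = x then k else 0,
      fun u => N.b u + if u = x then t - k else 0⟩ S := by
    refine h.solvable_of_isolate hk hx (by omega) ⟨fun u v => ?_,
      fun u v => sub_nonneg.2 (hst u v), fun u => ?_, h.q_nonneg, fun u hu => ?_⟩ ?_
      ⟨fun y hy => ?_, ?_⟩ (fun u v hu hv => ?_) (fun u hu => ?_) (fun _ _ => rfl)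
      (fun u hu hux => ?_) ?_ ?_ ih
    · simp only [h.symm u v, star_symm u v]
    · have := h.p_nonneg u
      dsimp only
      split_ifs with e <;> (try subst e) <;> omega
    · have h1 := h.degree u hu
      have h2 := sum_star_row hxT hx hTS u
      simp only [deg, Finset.sum_sub_distrib, h2] at h1 ⊢
      rw [hTc]
      split_ifs <;> linarith
    · simp [hxT]; omega
    · have h1 := h.m_le x hx y (Finset.mem_of_mem_erase hy) (Finset.ne_of_mem_erase hy).symm
      have h2 := star_nonneg (x := x) (T := T) x y
      simp only [hxT, if_true, if_false]
      nlinarith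
    · simp only [hxT, if_true, if_false]
      rcases min_cases (N.p x) (2 * k - t) with h1 | h1
      · nlinarith
      · nlinarith
    · simp [star_of_ne hu hv]
    · simp [hu]
    · have h1 := h.target_ge h.two_le_card u hu
      simp only [hux, if_false]
      split_ifs with e
      · have h2 := hnb u hu (Ne.symm hux) (hTm u e).2.2
        omega
      · omega
    · refine le_trans (Finset.sum_le_sum fun u _ => ?_) h.boundary_le
      dsimp only
      split_ifs <;> omega
    · refine dvd_congr (dvd_sub h.balance (dvd_refl (2 * k))) ?_
      simp only [Finset.sum_sub_distrib, Finset.sum_add_distrib, hcT, Finset.sum_ite_eq', hx,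
        if_true]
      ring
  refine Solvable.of_arrows hxT hx (fun _ _ => rfl) (fun u _ => ?_) hs
  dsimp only
  by_cases e : u = x
  · simp only [e, hxT, if_true, if_false]
    exact ⟨1, by ring⟩
  · simp only [e, if_false]
    exact ⟨0, by ring⟩

lemma Tight.solvable_of_not_improvable (hk : 3 ≤ k) (h : Tight k N S) (hI : ¬ Improvable k N S)
    (ih : ∀ (S' : Finset V) (N' : Network V), S'.card < S.card → Good k N' S' → Solvable k N' S') :
    Solvable k N S := by
  obtain ⟨x, hx⟩ : S.Nonempty := Finset.card_pos.1 (by have := h.two_le_card; omega)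
  have hI' : ¬ Improvable k N.flip S := fun h' => hI (h'.of_flip h.toValid)
  wlog hab : N.b x ≤ N.a x generalizing N
  · exact (this h.flip hI' hI (le_of_not_ge hab)).of_flip
      h.toValid
  have hz : ∀ y ∈ S, N.a y = k ^ 2 ∨ N.b y = k ^ 2 := fun y hy => by
    have h1 := h.target_ge h.two_le_card y hy
    by_contra! h2
    exact hI (h.improvable_of_lt hk hy (by omega) (by omega))
  have hle : N.a x ≤ k ^ 2 + k := not_lt.1 fun h1 => hI (h.improvable_of_large hk hx h1)
  have hxt := h.target_ge h.two_le_card x hx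
  have hb : N.b x = k ^ 2 := by have := hz x hx; omega
  have hzero : ∀ y ∈ S, N.a y = k ^ 2 → N.b y = k ^ 2 → Solvable k N S := fun y hy h1 h2 =>
    h.solvable_of_isolate hk hy (by omega) h.toValid (h1.trans h2.symm) (h.balanced hk hy)
      (fun _ _ _ _ => rfl) (fun _ _ => rfl) (fun _ _ => rfl)
      (fun u hu _ => h.target_ge h.two_le_card u hu) h.boundary_le h.balance ih
  rcases hxt.1.eq_or_lt with h1 | h1
  · exact hzero x hx h1.symm hb
  by_cases hall : ∃ y ∈ S, N.a y = k ^ 2 ∧ N.b y = k ^ 2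
  · obtain ⟨y, hy, h2, h3⟩ := hall
    exact hzero y hy h2 h3
  refine h.solvable_of_source hk hx h1 hle hb ?_ (fun y hy hxy hm => ?_) ih
  · have := h.q_nonneg x
    by_contra h2
    exact hI (h.improvable_of_half_edge hk hx h1 (by omega))
  · have h2 := h.target_ge h.two_le_card y hy
    by_contra h3
    refine hI (h.improvable_of_edge hk hx hy hxy hm h1 ?_)
    by_contra h4
    exact hall ⟨y, hy, by omega, by omega⟩

/-- Every good network is solvable. -/
theorem Good.solvable (hk : 3 ≤ k) :
    ∀ {S : Finset V} {N : Network V}, Good k N S → Solvable k N S := by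
  suffices H : ∀ c n : ℕ, ∀ (S : Finset V) (N : Network V), S.card = c →
      (∑ v ∈ S, (N.a v + N.b v)).toNat = n → Good k N S → Solvable k N S from
    fun {_ _} hG => H _ _ _ _ rfl rfl hG
  intro c
  induction c using Nat.strong_induction_on with
  | _ c ihc =>
  intro n
  induction n using Nat.strong_induction_on with
  | _ n ihn =>
  rintro S N rfl rfl hG
  have ih : ∀ (S' : Finset V) (N' : Network V), S'.card < S.card → Good k N' S' →
      Solvable k N' S' := fun S' N' hlt hG' => ihc _ hlt _ S' N' rfl rfl hG'
  by_cases h1 : S.card ≤ 1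
  · exact hG.solvable_of_card_le_one h1
  by_cases h2 : ∃ A ⊆ S, 2 ≤ A.card ∧ A ≠ S ∧ N.cut S A ≤ 4 * k ^ 2 - 2 * k + 2
  · obtain ⟨A, hA, hA2, hne, hcut⟩ := h2
    exact hG.solvable_of_cut_le hk hA hA2 hne hcut ih
  by_cases h3 : ∃ u ∈ S, ∃ v ∈ S, u ≠ v ∧ k - 1 ≤ N.m u v
  · obtain ⟨u, hu, v, hv, huv, hm⟩ := h3
    exact hG.solvable_of_le_m hk hu hv huv hm ih
  push Not at h2 h3
  have hT : Tight k N S := ⟨hG, by omega, fun A hA hA2 hne => by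
    have := h2 A hA hA2 hne; omega, fun u hu v hv huv => by have := h3 u hu v hv huv; omega⟩
  by_cases hI : Improvable k N S
  · obtain ⟨N', hG', hlt, hs⟩ := hI
    refine hs (ihn _ ?_ S N' rfl rfl hG')
    have h0 : 0 ≤ ∑ v ∈ S, (N'.a v + N'.b v) := Finset.sum_nonneg fun v hv => by
      have := hG'.target_ge (by omega) v hv
      nlinarith
    omega
  · exact hT.solvable_of_not_improvable hk hI ih

end Network

namespace Multigraph
variable {V E : Type} [Fintype E] [DecidableEq V] (G : Multigraph V E)

/-- The edges joining `u` and `v`. -/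
def joining (u v : V) : Finset E :=
  Finset.univ.filter fun e => (G.fst e = u ∧ G.snd e = v) ∨ (G.fst e = v ∧ G.snd e = u)

variable {G}

lemma mem_joining {u v : V} {e : E} : e ∈ G.joining u v ↔
    (G.fst e = u ∧ G.snd e = v) ∨ (G.fst e = v ∧ G.snd e = u) := by
  simp [joining]

lemma joining_comm (u v : V) : G.joining u v = G.joining v u := by
  ext e
  rw [mem_joining, mem_joining, or_comm]

/-- Edge numbers `x u v` with `x u v + x v u` equal to the multiplicity of `uv` are realized by
an orientation. -/
lemma exists_orientation [Fintype V] {x : V → V → ℤ} (h0 : ∀ u v, 0 ≤ x u v)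
    (h : ∀ u v, u ≠ v → x u v + x v u = (G.joining u v).card) :
    ∃ o : E → Bool, ∀ v, (G.outDeg o v : ℤ) = ∑ w ∈ Finset.univ.erase v, x v w := by
  classical
  have hF : ∀ u v, ∃ F : Finset E, u ≠ v → F ⊆ G.joining u v ∧ (F.card : ℤ) = x u v := by
    intro u v
    by_cases huv : u = v
    · exact ⟨∅, fun h => absurd huv h⟩
    · have h1 := h u v huv
      have h2 := h0 u v
      have h3 := h0 v u
      obtain ⟨F, hF, hF'⟩ := Finset.exists_subset_card_eq (s := G.joining u v)
        (n := (x u v).toNat) (by omega)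
      exact ⟨F, fun _ => ⟨hF, by omega⟩⟩
  choose F hF using hF
  let r : V → ℕ := fun v => Fintype.equivFin V v
  have hr : ∀ u v, u ≠ v → (r u < r v ↔ ¬ r v < r u) := fun u v huv => by
    have : r u ≠ r v := fun e => huv ((Fintype.equivFin V).injective (Fin.ext e))
    omega
  let W : V → V → Finset E := fun u v => if r u < r v then F u v else G.joining u v \ F v u
  have hWs : ∀ u v, u ≠ v → W u v ⊆ G.joining u v := fun u v huv => by
    dsimp only [W]
    split_ifs
    · exact (hF u v huv).1
    · exact Finset.sdiff_subset
  have hWc : ∀ u v, u ≠ v → ((W u v).card : ℤ) = x u v := fun u v huv => by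
    dsimp only [W]
    split_ifs
    · exact (hF u v huv).2
    · obtain ⟨h1, h2⟩ := hF v u huv.symm
      rw [joining_comm] at h1
      have h3 := Finset.card_sdiff_add_card_eq_card h1
      have h4 := h u v huv
      omega
  have hW : ∀ u v e, u ≠ v → e ∈ G.joining u v → (e ∈ W u v ↔ e ∉ W v u) := by
    intro u v e huv he
    have he' := he
    rw [joining_comm] at he'
    by_cases h1 : r u < r v
    · simp [W, h1, (hr u v huv).1 h1, he']
    · simp [W, h1, (hr v u huv.symm).2 h1, he]
  refine ⟨fun e => decide (e ∈ W (G.fst e) (G.snd e)), fun v => ?_⟩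
  have hset : {e | e ∈ (Set.univ : Set E) ∧
      G.tail (fun e => decide (e ∈ W (G.fst e) (G.snd e))) e = v} =
      ((Finset.univ.erase v).biUnion (W v) : Finset E) := by
    ext e
    have hl := G.loopless e
    have hW' := hW _ _ e hl (mem_joining.2 (Or.inl ⟨rfl, rfl⟩))
    simp only [Set.mem_univ, true_and, Set.mem_ofPred_eq, tail, decide_eq_true_eq, Finset.coe_biUnion,
      Set.mem_iUnion, Finset.mem_coe, Finset.mem_erase, Finset.mem_univ, and_true, exists_prop]
    constructor
    · intro he
      split_ifs at he with h1
      · subst he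
        exact ⟨_, hl.symm, h1⟩
      · subst he
        exact ⟨_, hl, not_not.1 fun h2 => h1 (hW'.2 h2)⟩
    · rintro ⟨w, hw, he⟩
      rcases mem_joining.1 (hWs v w hw.symm he) with ⟨rfl, rfl⟩ | ⟨rfl, rfl⟩
      · rw [if_pos he]
      · rw [if_neg fun h1 => hW'.1 h1 he]
  rw [outDeg, outDegOn, hset, Set.ncard_coe_finset, Finset.card_biUnion]
  · push_cast
    exact Finset.sum_congr rfl fun w hw => hWc v w (Finset.ne_of_mem_erase hw).symm
  · intro w hw w' hw' hne
    refine Finset.disjoint_left.2 fun e he he' => hne ?_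
    have h1 := mem_joining.1 (hWs _ _ (Finset.ne_of_mem_erase hw).symm he)
    have h2 := mem_joining.1 (hWs _ _ (Finset.ne_of_mem_erase hw').symm he')
    grind

variable (G) in
/-- The network of `G`, without boundary. -/
def network [Fintype V] (a b : V → ℤ) : Network V where
  m u v := (G.joining u v).card
  p _ := 0
  q _ := 0
  a := a
  b := b

lemma cut_network [Fintype V] (a b : V → ℤ) (A : Finset V) :
    (G.network a b).cut Finset.univ A = (G.cutEdges A).ncard := by
  classical
  have hset : G.cutEdges A =
      ((A ×ˢ (Finset.univ \ A)).biUnion fun z => G.joining z.1 z.2 : Finset E) := by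
    ext e
    simp only [cutEdges, Set.mem_ofPred_eq, Finset.coe_biUnion, Set.mem_iUnion, Finset.mem_coe,
      Finset.mem_product, Finset.mem_sdiff, Finset.mem_univ, true_and, mem_joining, Prod.exists,
      exists_prop]
    grind
  rw [hset, Set.ncard_coe_finset, Finset.card_biUnion, Finset.sum_product]
  · simp [Network.cut, network]
  · intro z hz z' hz' hne
    simp only [Finset.coe_product, Set.mem_prod, Finset.mem_coe, Finset.mem_sdiff,
      Finset.mem_univ, true_and] at hz hz'
    refine Finset.disjoint_left.2 fun e he he' => hne ?_
    rw [mem_joining] at he he'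
    rw [Prod.ext_iff]
    grind

lemma deg_network [Fintype V] (a b : V → ℤ) (v : V) :
    (G.network a b).deg Finset.univ v = (G.cutEdges {v}).ncard := by
  rw [← Network.cut_singleton, cut_network, Finset.coe_singleton]

lemma sum_ncard_cutEdges_singleton [Fintype V] :
    ∑ v, (G.cutEdges {v}).ncard = 2 * Fintype.card E := by
  have h : ∀ v, (G.cutEdges {v}).ncard =
      (Finset.univ.filter fun e => G.fst e = v).card +
        (Finset.univ.filter fun e => G.snd e = v).card := by
    intro v
    classical
    rw [← Finset.card_union_of_disjoint, ← Set.ncard_coe_finset]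
    · congr 1
      ext e
      have := G.loopless e
      simp only [cutEdges, Set.mem_ofPred_eq, Set.mem_singleton_iff, Finset.coe_union,
        Finset.coe_filter, Finset.mem_univ, true_and, Set.mem_union]
      grind
    · refine Finset.disjoint_filter.2 fun e _ h1 h2 => G.loopless e (h1.trans h2.symm)
  simp only [h, Finset.sum_add_distrib]
  rw [← Finset.card_eq_sum_card_fiberwise fun _ _ => Finset.mem_coe.2 (Finset.mem_univ _),
    ← Finset.card_eq_sum_card_fiberwise fun _ _ => Finset.mem_coe.2 (Finset.mem_univ _),
    Finset.card_univ, two_mul]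

lemma good_network [Fintype V] {k : ℕ} (hk : 3 ≤ k) (hconn : G.EdgeConnected (2 * k ^ 2 + k))
    (a : V → ℤ) (ha : ∀ v, (k : ℤ) ^ 2 ≤ a v ∧ a v < (k : ℤ) ^ 2 + k)
    (hdvd : (k : ℤ) ∣ ∑ v, a v - Fintype.card E) :
    Network.Good k (G.network a fun v => (G.cutEdges {v}).ncard - a v) Finset.univ where
  symm u v := by simp only [network, joining_comm]
  m_nonneg _ _ := Int.natCast_nonneg _
  p_nonneg _ := le_rfl
  q_nonneg _ := le_rfl
  degree v _ := by
    rw [deg_network]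
    simp [network]
  boundary_le := by
    simp only [network, add_zero, Finset.sum_const_zero]
    nlinarith [(by exact_mod_cast hk : (3 : ℤ) ≤ k)]
  target_ge h2 v _ := by
    have h3 := hconn.2 {v} (Set.singleton_nonempty v) fun e => by
      rw [← Finset.coe_singleton, Finset.coe_eq_univ] at e
      rw [← e] at h2
      simp at h2
    have h4 := ha v
    zify at h3
    simp only [network]
    constructor <;> linarith
  cut_ge A _ hA2 hA := by
    rw [cut_network]
    exact_mod_cast hconn.2 A (Finset.coe_nonempty.2 (Finset.card_pos.1 (by omega)))
      fun e => hA (Finset.coe_eq_univ.1 e)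
  balance := by
    have h := congrArg (Nat.cast : ℕ → ℤ) (sum_ncard_cutEdges_singleton (G := G))
    push_cast at h
    refine Network.dvd_congr (mul_dvd_mul_left 2 hdvd) ?_
    simp only [network, Finset.sum_sub_distrib, Finset.sum_add_distrib, h]
    simp
    ring

end Multigraph

/-- Thomassen 2012: if `k ≥ 3`, `G` is `(2k² + k)`-edge-connected,
and `f : V → ZMod k` satisfies `|E(G)| ≡ ∑ v, f v (mod k)`, then `G` has an
`f`-orientation. -/
theorem edgeConnected_two_k_sq_add_k_has_mod_orientation
    {V E : Type} [Fintype V] [Fintype E] (G : Multigraph V E)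
    (k : ℕ) (hk : 3 ≤ k)
    (hconn : G.EdgeConnected (2 * k ^ 2 + k))
    (f : V → ZMod k) (hf : (Nat.card E : ZMod k) = ∑ v, f v) :
    ∃ o : E → Bool, G.IsModOrientation k f o := by
  classical
  have : NeZero k := ⟨by omega⟩
  let a : V → ℤ := fun v => (k : ℤ) ^ 2 + (f v).val
  have hcast : ∀ v, (a v : ZMod k) = f v := fun v => by simp [a]
  have ha : ∀ v, (k : ℤ) ^ 2 ≤ a v ∧ a v < (k : ℤ) ^ 2 + k := fun v => by
    have := ZMod.val_lt (f v)
    dsimp only [a]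
    omega
  have hdvd : (k : ℤ) ∣ ∑ v, a v - Fintype.card E := by
    rw [← ZMod.intCast_zmod_eq_zero_iff_dvd]
    push_cast
    simp only [hcast, ← hf, Nat.card_eq_fintype_card, sub_self]
  obtain ⟨x, h0, h1, h2⟩ := (Multigraph.good_network hk hconn a ha hdvd).solvable
    (by exact_mod_cast hk)
  obtain ⟨o, ho⟩ := Multigraph.exists_orientation h0
    fun u v huv => h1 u (Finset.mem_univ u) v (Finset.mem_univ v) huv
  refine ⟨o, fun v => ?_⟩
  have h3 := h2 v (Finset.mem_univ v)
  rw [← ho v, ← ZMod.intCast_zmod_eq_zero_iff_dvd] at h3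
  simp only [Multigraph.network, add_zero] at h3
  push_cast at h3
  rw [hcast, sub_eq_zero] at h3
  exact h3
end

section
/- Let k be an integer with k ≥ 3 and set λ'_k = 3k−3 if k is odd and λ'_k = 3k−2 if k is even. If G is a λ'_k-edge-connected graph and f : V(G) → Z_k is a mapping with |E(G)| ≡ Σ_{v∈V(G)} f(v) (mod k), then G admits an f-orientation. -/
namespace RootedOrientation

open scoped Pointwise

variable {V : Type} [DecidableEq V]

/-- The net outflow of a single edge oriented from its first to its second endpoint. -/
def edgeFlow (e : V × V) : V → ℤ := Pi.single e.1 1 - Pi.single e.2 1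

/-- The functions `outdegree - indegree` arising from orientations of the edges of `F`. -/
def divergences (F : Multiset (V × V)) : Set (V → ℤ) :=
  (F.map fun e => ({edgeFlow e, -edgeFlow e} : Set (V → ℤ))).sum

/-- The contribution of the edge `e` to the cut around `A`. -/
def crossing (A : Finset V) (e : V × V) : ℤ := if e.1 ∈ A ↔ e.2 ∈ A then 0 else 1

/-- The number of edges of `F` with exactly one end in `A`. -/
def cut (F : Multiset (V × V)) (A : Finset V) : ℤ := (F.map (crossing A)).sum

theorem edgeFlow_swap (e : V × V) : edgeFlow e.swap = -edgeFlow e := by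
  simp [edgeFlow]

theorem sum_edgeFlow (A : Finset V) (e : V × V) :
    ∑ x ∈ A, edgeFlow e x = (if e.1 ∈ A then 1 else 0) - (if e.2 ∈ A then 1 else 0) := by
  simp [edgeFlow, Finset.sum_pi_single']

theorem crossing_swap (A : Finset V) (e : V × V) : crossing A e.swap = crossing A e := by
  simp [crossing, iff_comm]

theorem crossing_nonneg (A : Finset V) (e : V × V) : 0 ≤ crossing A e := by
  unfold crossing; split_ifs <;> simp

@[simp]
theorem cut_zero (A : Finset V) : cut (0 : Multiset (V × V)) A = 0 := by simp [cut]

@[simp]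
theorem cut_cons (e : V × V) (F : Multiset (V × V)) (A : Finset V) :
    cut (e ::ₘ F) A = crossing A e + cut F A := by simp [cut]

@[simp]
theorem cut_add (F F' : Multiset (V × V)) (A : Finset V) :
    cut (F + F') A = cut F A + cut F' A := by simp [cut]

theorem cut_nonneg (F : Multiset (V × V)) (A : Finset V) : 0 ≤ cut F A := by
  refine Multiset.sum_nonneg fun x hx => ?_
  obtain ⟨e, -, rfl⟩ := Multiset.mem_map.1 hx
  exact crossing_nonneg A e

theorem cut_congr {F : Multiset (V × V)} {A B : Finset V}
    (h : ∀ e ∈ F, (e.1 ∈ A ↔ e.2 ∈ A) ↔ (e.1 ∈ B ↔ e.2 ∈ B)) : cut F A = cut F B := by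
  unfold cut
  rw [Multiset.map_congr rfl fun e he => ?_]
  simp only [crossing, h e he]

theorem cut_eq_zero {F : Multiset (V × V)} {A : Finset V}
    (h : ∀ e ∈ F, e.1 ∈ A ↔ e.2 ∈ A) : cut F A = 0 := by
  refine Multiset.sum_eq_zero fun x hx => ?_
  obtain ⟨e, he, rfl⟩ := Multiset.mem_map.1 hx
  simp [crossing, h e he]

theorem mem_divergences_zero {β : V → ℤ} : β ∈ divergences (0 : Multiset (V × V)) ↔ β = 0 := by
  simp [divergences]

theorem mem_divergences_cons {e : V × V} {F : Multiset (V × V)} {β : V → ℤ} :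
    β ∈ divergences (e ::ₘ F) ↔
      ∃ γ ∈ divergences F, β = edgeFlow e + γ ∨ β = -edgeFlow e + γ := by
  simp only [divergences, Multiset.map_cons, Multiset.sum_cons, Set.mem_add, Set.mem_insert_iff,
    Set.mem_singleton_iff, exists_eq_or_imp, exists_eq_left]
  constructor
  · rintro (⟨γ, h, rfl⟩ | ⟨γ, h, rfl⟩)
    exacts [⟨γ, h, .inl rfl⟩, ⟨γ, h, .inr rfl⟩]
  · rintro ⟨γ, h, rfl | rfl⟩
    exacts [.inl ⟨γ, h, rfl⟩, .inr ⟨γ, h, rfl⟩]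

theorem mem_divergences_add {F F' : Multiset (V × V)} {β : V → ℤ} :
    β ∈ divergences (F + F') ↔ ∃ γ ∈ divergences F, ∃ δ ∈ divergences F', γ + δ = β := by
  simp [divergences, Set.mem_add]

theorem divergences_swap_cons (e : V × V) (F : Multiset (V × V)) :
    divergences (e.swap ::ₘ F) = divergences (e ::ₘ F) := by
  simp [divergences, edgeFlow_swap, Set.pair_comm]

theorem divergences_nonempty (F : Multiset (V × V)) : (divergences F).Nonempty := by
  induction F using Multiset.induction with
  | empty => exact ⟨0, mem_divergences_zero.2 rfl⟩
  | cons e F ih =>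
    obtain ⟨γ, h⟩ := ih
    exact ⟨_, mem_divergences_cons.2 ⟨γ, h, .inl rfl⟩⟩

theorem neg_mem_divergences {F : Multiset (V × V)} {β : V → ℤ} (h : β ∈ divergences F) :
    -β ∈ divergences F := by
  induction F using Multiset.induction generalizing β with
  | empty => simpa [mem_divergences_zero] using h
  | cons e F ih =>
    obtain ⟨γ, hγ, rfl | rfl⟩ := mem_divergences_cons.1 h
    · exact mem_divergences_cons.2 ⟨-γ, ih hγ, .inr (neg_add _ _)⟩
    · exact mem_divergences_cons.2 ⟨-γ, ih hγ, .inl (by rw [neg_add, neg_neg])⟩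

theorem sum_eq_zero_of_mem_divergences {F : Multiset (V × V)} {A : Finset V} {β : V → ℤ}
    (hβ : β ∈ divergences F) (h : ∀ e ∈ F, e.1 ∈ A ↔ e.2 ∈ A) : ∑ x ∈ A, β x = 0 := by
  induction F using Multiset.induction generalizing β with
  | empty => simp [mem_divergences_zero.1 hβ]
  | cons e F ih =>
    simp only [Multiset.mem_cons, forall_eq_or_imp] at h
    obtain ⟨γ, hγ, rfl | rfl⟩ := mem_divergences_cons.1 hβ <;>
      simp [Finset.sum_add_distrib, sum_edgeFlow, ih hγ h.2, h.1]

theorem apply_eq_zero_of_mem_divergences {F : Multiset (V × V)} {x : V} {β : V → ℤ}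
    (hβ : β ∈ divergences F) (h : ∀ e ∈ F, e.1 ≠ x ∧ e.2 ≠ x) : β x = 0 := by
  simpa using sum_eq_zero_of_mem_divergences (A := {x}) hβ (by
    intro e he; simp [h e he])

/-- An orientation of the path `u v w` can be obtained from one of the edge `u w`. -/
theorem divergences_lift_subset (u v w : V) (F : Multiset (V × V)) :
    divergences ((u, w) ::ₘ F) ⊆ divergences ((u, v) ::ₘ (v, w) ::ₘ F) := by
  intro β h
  obtain ⟨γ, hγ, rfl | rfl⟩ := mem_divergences_cons.1 h
  · refine mem_divergences_cons.2 ⟨_, mem_divergences_cons.2 ⟨γ, hγ, .inl rfl⟩, .inl ?_⟩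
    simp only [edgeFlow]; abel
  · refine mem_divergences_cons.2 ⟨_, mem_divergences_cons.2 ⟨γ, hγ, .inr rfl⟩, .inr ?_⟩
    simp only [edgeFlow]; abel

theorem exists_mem_divergences_of_map {F : Multiset (V × V)} {W : Finset V} (π : V → V)
    (hF : ∀ e ∈ F, e.1 ∈ W ∧ e.2 ∈ W) {γ : V → ℤ}
    (hγ : γ ∈ divergences (F.map (Prod.map π π))) :
    ∃ β ∈ divergences F, ∀ y, ∑ x ∈ W with π x = y, β x = γ y := by
  induction F using Multiset.induction generalizing γ with
  | empty => exact ⟨0, mem_divergences_zero.2 rfl, by simp_all [mem_divergences_zero]⟩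
  | cons e F ih =>
    simp only [Multiset.mem_cons, forall_eq_or_imp] at hF
    rw [Multiset.map_cons] at hγ
    have key : ∀ y, ∑ x ∈ W with π x = y, edgeFlow e x = edgeFlow (Prod.map π π e) y := by
      intro y
      rw [sum_edgeFlow]
      simp [edgeFlow, Pi.single_apply, hF.1.1, hF.1.2, eq_comm]
    obtain ⟨δ, hδ, h⟩ := mem_divergences_cons.1 hγ
    obtain ⟨β, hβ, hβδ⟩ := ih hF.2 hδ
    rcases h with rfl | rfl
    · refine ⟨_, mem_divergences_cons.2 ⟨β, hβ, .inl rfl⟩, fun y => ?_⟩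
      simp [Finset.sum_add_distrib, key, hβδ]
    · refine ⟨_, mem_divergences_cons.2 ⟨β, hβ, .inr rfl⟩, fun y => ?_⟩
      simp [Finset.sum_add_distrib, key, hβδ]

/-- The half-edges in `A` of an orientation of edges not contained in `A`, sorted by direction. -/
theorem exists_in_out_of_mem_divergences {F : Multiset (V × V)} {A : Finset V} {β : V → ℤ}
    (hβ : β ∈ divergences F) (hF : ∀ e ∈ F, ¬(e.1 ∈ A ∧ e.2 ∈ A)) :
    ∃ P Q : V → ℤ, (∀ x, 0 ≤ P x) ∧ (∀ x, 0 ≤ Q x) ∧ (∀ x, Q x - P x = β x) ∧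
      ∀ B ⊆ A, ∑ x ∈ B, P x + ∑ x ∈ B, Q x = cut F B := by
  induction F using Multiset.induction generalizing β with
  | empty => exact ⟨0, 0, by simp, by simp, by simp [mem_divergences_zero.1 hβ], by simp⟩
  | cons e F ih =>
    simp only [Multiset.mem_cons, forall_eq_or_imp] at hF
    obtain ⟨γ, hγ, h⟩ := mem_divergences_cons.1 hβ
    obtain ⟨P, Q, hP, hQ, hPQ, hcut⟩ := ih hγ hF.2
    have key : ∀ B ⊆ A, (if e.1 ∈ B then (1 : ℤ) else 0) + (if e.2 ∈ B then 1 else 0) =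
        crossing B e := by
      intro B hB
      have := hF.1
      have h1 := @hB e.1
      have h2 := @hB e.2
      unfold crossing
      split_ifs <;> simp_all
    have hs : ∀ u x : V, 0 ≤ (Pi.single u 1 : V → ℤ) x := fun u x => by
      rw [Pi.single_apply]; split_ifs <;> simp
    rcases h with rfl | rfl
    · refine ⟨P + Pi.single e.2 1, Q + Pi.single e.1 1, fun x => add_nonneg (hP x) (hs _ x),
        fun x => add_nonneg (hQ x) (hs _ x), fun x => ?_, fun B hB => ?_⟩
      · simp only [edgeFlow, Pi.add_apply, Pi.sub_apply, ← hPQ]; ring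
      · rw [cut_cons, ← hcut B hB, ← key B hB]
        simp only [Pi.add_apply, Finset.sum_add_distrib, Finset.sum_pi_single']; ring
    · refine ⟨P + Pi.single e.1 1, Q + Pi.single e.2 1, fun x => add_nonneg (hP x) (hs _ x),
        fun x => add_nonneg (hQ x) (hs _ x), fun x => ?_, fun B hB => ?_⟩
      · simp only [edgeFlow, Pi.add_apply, Pi.sub_apply, Pi.neg_apply, ← hPQ]; ring
      · rw [cut_cons, ← hcut B hB, ← key B hB]
        simp only [Pi.add_apply, Finset.sum_add_distrib, Finset.sum_pi_single']; ring

/-- Parallel edges and loops can be oriented with any prescribed in- and out-degree. -/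
theorem smul_edgeFlow_mem_divergences {F : Multiset (V × V)} {u v : V} (huv : u ≠ v)
    (hF : ∀ e ∈ F, e = (v, v) ∨ e = (v, u) ∨ e = (u, v)) {o n : ℤ} (ho : 0 ≤ o) (hn : 0 ≤ n)
    (h : o + n = cut F {v}) : (o - n) • edgeFlow (v, u) ∈ divergences F := by
  induction F using Multiset.induction generalizing o n with
  | empty =>
    rw [cut_zero] at h
    obtain rfl : o = 0 := by omega
    obtain rfl : n = 0 := by omega
    simp [mem_divergences_zero]
  | cons e F ih =>
    simp only [Multiset.mem_cons, forall_eq_or_imp] at hF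
    rw [cut_cons] at h
    have h0 := cut_nonneg F {v}
    have step : ∀ e', edgeFlow e' = edgeFlow (v, u) → o + n = 1 + cut F {v} →
        (o - n) • edgeFlow (v, u) ∈ divergences (e' ::ₘ F) := by
      intro e' he' h
      rw [mem_divergences_cons, he']
      by_cases ho' : 1 ≤ o
      · refine ⟨_, ih hF.2 (o := o - 1) (by omega) hn (by omega), .inl ?_⟩
        module
      · refine ⟨_, ih hF.2 (n := n - 1) ho (by omega) (by omega), .inr ?_⟩
        module
    rcases hF.1 with rfl | rfl | rfl
    · rw [mem_divergences_cons]
      exact ⟨_, ih hF.2 ho hn (by simpa [crossing] using h), .inl (by simp [edgeFlow])⟩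
    · exact step _ rfl (by simpa [crossing, huv] using h)
    · rw [← Prod.swap_prod_mk, divergences_swap_cons]
      exact step _ rfl (by simpa [crossing, huv] using h)

/-- Some split `o + n = D` into at least `j` outgoing and at least `j` ingoing edges has
`o - n` congruent to `μ` modulo `2k`. -/
def Splits (k j D μ : ℤ) : Prop := ∃ o n : ℤ, o + n = D ∧ 2 * k ∣ o - n - μ ∧ j ≤ o ∧ j ≤ n

theorem Splits.shift {k j D μ : ℤ} (h : Splits k j D μ) (a b : ℤ) {j' D' μ' : ℤ}
    (hD : D' = D + a + b) (hμ : 2 * k ∣ μ + a - b - μ') (ha : j' ≤ j + a) (hb : j' ≤ j + b) :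
    Splits k j' D' μ' := by
  obtain ⟨o, n, h1, h2, h3, h4⟩ := h
  refine ⟨o + a, n + b, by omega, ?_, by omega, by omega⟩
  refine (dvd_add h2 hμ).trans (Eq.dvd ?_)
  ring

theorem Splits.mono {k j j' D μ : ℤ} (h : Splits k j D μ) (hj : j' ≤ j) : Splits k j' D μ :=
  h.shift 0 0 (by ring) (by simp) (by omega) (by omega)

theorem Splits.add {k j D μ j' D' μ' : ℤ} (h : Splits k j D μ) (h' : Splits k j' D' μ') :
    Splits k (j + j') (D + D') (μ + μ') := by
  obtain ⟨o, n, h1, h2, h3, h4⟩ := h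
  obtain ⟨o', n', h1', h2', h3', h4'⟩ := h'
  refine ⟨o + o', n + n', by omega, ?_, by omega, by omega⟩
  refine (dvd_add h2 h2').trans (Eq.dvd ?_)
  ring

theorem Splits.neg {k j D μ : ℤ} (h : Splits k j D μ) : Splits k j D (-μ) := by
  obtain ⟨o, n, h1, h2, h3, h4⟩ := h
  refine ⟨n, o, by omega, ?_, h4, h3⟩
  rw [← dvd_neg]
  refine h2.trans (Eq.dvd ?_)
  ring

theorem splits_neg {k j D μ : ℤ} : Splits k j D (-μ) ↔ Splits k j D μ :=
  ⟨fun h => by simpa using h.neg, Splits.neg⟩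

/-- Large cuts make every demand of the right parity flexible. -/
theorem splits_of_le {k d m : ℤ} (hk : 0 < k) (hd : 3 * k - 3 ≤ d) :
    Splits k (k - 1) d (2 * m - d) := by
  have h1 := Int.emod_nonneg (m - (k - 1)) hk.ne'
  have h2 := Int.emod_lt_of_pos (m - (k - 1)) hk
  have h3 := Int.emod_add_mul_ediv (m - (k - 1)) k
  set r := (m - (k - 1)) % k
  refine ⟨k - 1 + r, d - (k - 1 + r), by ring, ⟨-((m - (k - 1)) / k), ?_⟩, by omega, by omega⟩
  linear_combination 2 * h3

/-- A graph with a root: `F` are the edges avoiding the root, which are to be oriented, while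
`p x` edges oriented from the root to `x` and `q x` edges oriented from `x` to the root are given.
The demand `τ` prescribes `outdegree - indegree`. -/
structure RootedGraph (V : Type) where
  F : Multiset (V × V)
  p : V → ℤ
  q : V → ℤ
  τ : V → ℤ

namespace RootedGraph

variable (I : RootedGraph V) {k : ℤ} {W : Finset V} {z : V}

/-- The degree of a vertex set. -/
def deg (A : Finset V) : ℤ := cut I.F A + (∑ x ∈ A, I.p x + ∑ x ∈ A, I.q x)

/-- The total demand of a vertex set. -/
def demand (A : Finset V) : ℤ := ∑ x ∈ A, I.τ x

/-- `A` is balanced if its demand is met by equally many outgoing and ingoing edges. -/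
def Balanced (k : ℤ) (A : Finset V) : Prop := ∃ o, 2 * o = I.deg A ∧ 2 * k ∣ I.demand A

/-- The demand on the vertices in `W` can be met modulo `2k`. -/
def Solvable (k : ℤ) (W : Finset V) : Prop :=
  ∃ β ∈ divergences I.F, ∀ x ∈ W, 2 * k ∣ β x - (I.τ x - I.q x + I.p x)

/-- Basic consistency requirements on a rooted graph with non-root vertex set `W`. -/
structure Consistent (k : ℤ) (W : Finset V) : Prop where
  mem : ∀ e ∈ I.F, e.1 ∈ W ∧ e.2 ∈ W
  p_nonneg : ∀ x, 0 ≤ I.p x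
  q_nonneg : ∀ x, 0 ≤ I.q x
  dvd : 2 * k ∣ I.demand W - ∑ x ∈ W, I.q x + ∑ x ∈ W, I.p x
  not_splits : ¬ Splits k k (I.deg W) (I.demand W)

/-- The hypotheses of the orientation theorem, with exceptional vertex `z`. -/
structure Admissible (k : ℤ) (W : Finset V) (z : V) : Prop extends I.Consistent k W where
  splits : ∀ A ⊆ W, A.Nonempty → A ≠ W →
    Splits k (k - 1) (I.deg A) (I.demand A) ∨ A = {z} ∧ I.Balanced k A

variable {I}

theorem Consistent.deg_self (h : I.Consistent k W) :
    I.deg W = ∑ x ∈ W, I.p x + ∑ x ∈ W, I.q x := by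
  rw [deg, cut_eq_zero, zero_add]
  exact fun e he => by simp [h.mem e he]

/-- Two parts without edges between them cannot both have a flexible split. -/
theorem Consistent.not_splits_compl (h : I.Consistent k W) {A : Finset V} (hA : A ⊆ W)
    (hcut : cut I.F A = 0) {j j' : ℤ} (hj : k ≤ j + j')
    (h1 : Splits k j (I.deg A) (I.demand A))
    (h2 : Splits k j' (I.deg (W \ A)) (I.demand (W \ A))) : False := by
  refine h.not_splits (((h1.add h2).mono hj).shift 0 0 ?_ ?_ (by omega) (by omega))
  · have : cut I.F (W \ A) = cut I.F A := cut_congr fun e he => by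
      have := h.mem e he
      simp only [Finset.mem_sdiff, this, true_and]
      tauto
    rw [h.deg_self, deg, deg, this, hcut, ← Finset.sum_sdiff hA, ← Finset.sum_sdiff hA]
    ring
  · simp only [demand]
    rw [← Finset.sum_sdiff hA]
    ring_nf
    simp

/-- Reversing all directions. -/
def reverse (I : RootedGraph V) : RootedGraph V := ⟨I.F, I.q, I.p, -I.τ⟩

theorem reverse_deg (A : Finset V) : I.reverse.deg A = I.deg A := by
  simp only [deg, reverse]; ring

omit [DecidableEq V] in
theorem reverse_demand (A : Finset V) : I.reverse.demand A = -I.demand A := by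
  simp [demand, reverse]

theorem Balanced.reverse {A : Finset V} (h : I.Balanced k A) : I.reverse.Balanced k A := by
  simpa [Balanced, reverse_deg, reverse_demand] using h

theorem Consistent.reverse (h : I.Consistent k W) : I.reverse.Consistent k W where
  mem := h.mem
  p_nonneg := h.q_nonneg
  q_nonneg := h.p_nonneg
  dvd := by
    rw [← dvd_neg, reverse_demand]
    refine h.dvd.trans (Eq.dvd ?_)
    simp only [RootedGraph.reverse]; ring
  not_splits := by
    rw [reverse_deg, reverse_demand, splits_neg]
    exact h.not_splits

theorem Admissible.reverse (h : I.Admissible k W z) : I.reverse.Admissible k W z where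
  toConsistent := h.toConsistent.reverse
  splits A hA hne hW := by
    rw [reverse_deg, reverse_demand, splits_neg]
    exact (h.splits A hA hne hW).imp_right fun h => ⟨h.1, h.2.reverse⟩

omit [DecidableEq V] in
theorem reverse_reverse : I.reverse.reverse = I := by
  simp [RootedGraph.reverse]

theorem Solvable.reverse (h : I.Solvable k W) : I.reverse.Solvable k W := by
  obtain ⟨β, hβ, h⟩ := h
  refine ⟨-β, neg_mem_divergences hβ, fun x hx => ?_⟩
  rw [← dvd_neg]
  refine (h x hx).trans (Eq.dvd ?_)
  simp only [RootedGraph.reverse, Pi.neg_apply]; ring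

theorem solvable_reverse : I.reverse.Solvable k W ↔ I.Solvable k W :=
  ⟨fun h => by simpa [reverse_reverse] using h.reverse, Solvable.reverse⟩

/-- Vertex sets with at most one element pose no problem. -/
theorem Consistent.solvable_of_card_le_one (h : I.Consistent k W) (hW : W.card ≤ 1) :
    I.Solvable k W := by
  obtain ⟨β, hβ⟩ := divergences_nonempty I.F
  refine ⟨β, hβ, fun x hx => ?_⟩
  obtain rfl : W = {x} := Finset.eq_singleton_iff_unique_mem.2
    ⟨hx, fun y hy => Finset.card_le_one.1 hW y hy x hx⟩
  have h0 := sum_eq_zero_of_mem_divergences hβ (A := {x}) fun e he => by simp_all [h.mem e he]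
  have := h.dvd
  simp only [demand, Finset.sum_singleton] at h0 this
  rw [h0, zero_sub, dvd_neg]
  exact this

/-- Identify vertices of `W` along `π`. -/
def contract (I : RootedGraph V) (W : Finset V) (π : V → V) : RootedGraph V where
  F := I.F.map (Prod.map π π)
  p y := ∑ x ∈ W with π x = y, I.p x
  q y := ∑ x ∈ W with π x = y, I.q x
  τ y := ∑ x ∈ W with π x = y, I.τ x

theorem contract_demand (π : V → V) (B : Finset V) :
    (I.contract W π).demand B = I.demand {x ∈ W | π x ∈ B} :=
  Finset.sum_fiberwise_eq_sum_filter ..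

theorem Consistent.contract_deg (h : I.Consistent k W) (π : V → V) (B : Finset V) :
    (I.contract W π).deg B = I.deg {x ∈ W | π x ∈ B} := by
  simp only [deg, RootedGraph.contract, Finset.sum_fiberwise_eq_sum_filter]
  congr 1
  rw [cut, cut, Multiset.map_map]
  refine congrArg _ (Multiset.map_congr rfl fun e he => ?_)
  simp [crossing, h.mem e he]

theorem Admissible.contract (h : I.Admissible k W z) (π : V → V) :
    (I.contract W π).Admissible k (W.image π) (π z) := by
  have hW : {x ∈ W | π x ∈ W.image π} = W :=
    Finset.filter_true_of_mem fun x hx => Finset.mem_image_of_mem π hx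
  refine ⟨⟨?_, fun y => Finset.sum_nonneg fun x _ => h.p_nonneg x,
    fun y => Finset.sum_nonneg fun x _ => h.q_nonneg x, ?_, ?_⟩, fun B hB hne hBW => ?_⟩
  · intro e he
    obtain ⟨e', he', rfl⟩ := Multiset.mem_map.1 he
    exact ⟨Finset.mem_image_of_mem π (h.mem _ he').1, Finset.mem_image_of_mem π (h.mem _ he').2⟩
  · rw [contract_demand]
    simp only [RootedGraph.contract, Finset.sum_fiberwise_eq_sum_filter]
    rw [hW]
    exact h.dvd
  · rw [contract_demand, h.contract_deg, hW]
    exact h.not_splits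
  · have hBi : Finset.image π {x ∈ W | π x ∈ B} = B := by
      ext y
      simp only [Finset.mem_image, Finset.mem_filter]
      constructor
      · rintro ⟨x, ⟨-, hx⟩, rfl⟩
        exact hx
      · intro hy
        obtain ⟨x, hx, rfl⟩ := Finset.mem_image.1 (hB hy)
        exact ⟨x, ⟨hx, hy⟩, rfl⟩
    unfold Balanced
    rw [contract_demand, h.contract_deg]
    refine (h.splits _ (Finset.filter_subset _ _) ?_ ?_).imp_right fun h => ⟨?_, h.2⟩
    · rw [← Finset.image_nonempty (f := π), hBi]
      exact hne
    · intro h'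
      rw [h'] at hBi
      exact hBW hBi.symm
    · rw [← hBi, h.1, Finset.image_singleton]

/-- Contract a set `A` without flexible split, orient, and then orient inside `A`. -/
theorem Admissible.solvable_of_tight (h : I.Admissible k W z)
    (ih : ∀ W' : Finset V, W'.card < W.card → ∀ z (I : RootedGraph V),
      I.Admissible k W' z → I.Solvable k W')
    {A : Finset V} (hA : A ⊆ W) (hAW : A ≠ W) (hcard : 2 ≤ A.card)
    (hs : ¬ Splits k k (I.deg A) (I.demand A)) : I.Solvable k W := by
  obtain ⟨a, ha⟩ : A.Nonempty := Finset.card_pos.1 (by omega)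
  set π : V → V := fun x => if x ∈ A then a else x with hπ
  have hfibA : {x ∈ W | π x = a} = A := by
    ext x
    simp only [hπ, Finset.mem_filter]
    constructor
    · rintro ⟨-, hx⟩
      by_contra hxA
      rw [if_neg hxA] at hx
      exact hxA (hx ▸ ha)
    · intro hx
      exact ⟨hA hx, if_pos hx⟩
  have hfib : ∀ x ∈ W, x ∉ A → {y ∈ W | π y = x} = {x} := by
    intro x hx hxA
    ext y
    simp only [hπ, Finset.mem_filter, Finset.mem_singleton]
    constructor
    · rintro ⟨-, hy⟩
      split_ifs at hy with hyA
      · exact absurd (hy ▸ ha) hxA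
      · exact hy
    · rintro rfl
      exact ⟨hx, if_neg hxA⟩
  have hlt : (W.image π).card < W.card := by
    have h1 : W.image π ⊆ insert a (W \ A) := by
      intro y hy
      obtain ⟨x, hx, rfl⟩ := Finset.mem_image.1 hy
      by_cases hxA : x ∈ A <;> simp [hπ, hxA, hx]
    have h2 := (Finset.card_le_card h1).trans (Finset.card_insert_le _ _)
    have h3 := Finset.card_sdiff_add_card_eq_card hA
    omega
  obtain ⟨γ, hγ, hγτ⟩ := ih _ hlt _ _ (h.contract π)
  obtain ⟨β, hβ, hβγ⟩ := exists_mem_divergences_of_map π h.mem hγ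
  have hβA : 2 * k ∣ ∑ x ∈ A, β x - (∑ x ∈ A, I.τ x - ∑ x ∈ A, I.q x + ∑ x ∈ A, I.p x) := by
    have := hγτ a (Finset.mem_image.2 ⟨a, hA ha, by simp [hπ]⟩)
    simpa only [← hβγ, RootedGraph.contract, hfibA] using this
  have hβW : ∀ x ∈ W, x ∉ A → 2 * k ∣ β x - (I.τ x - I.q x + I.p x) := by
    intro x hx hxA
    have := hγτ x (Finset.mem_image.2 ⟨x, hx, by simp [hπ, hxA]⟩)
    simpa only [← hβγ, RootedGraph.contract, hfib x hx hxA, Finset.sum_singleton] using this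
  set FA := I.F.filter fun e => e.1 ∈ A ∧ e.2 ∈ A
  set F' := I.F.filter fun e => ¬(e.1 ∈ A ∧ e.2 ∈ A)
  have hFA : ∀ e ∈ FA, e.1 ∈ A ∧ e.2 ∈ A := fun e he => (Multiset.mem_filter.1 he).2
  have hF : FA + F' = I.F := Multiset.filter_add_not _ _
  rw [← hF] at hβ
  obtain ⟨βA, hβA', β', hβ', rfl⟩ := mem_divergences_add.1 hβ
  obtain ⟨P, Q, hP, hQ, hPQ, hcut⟩ :=
    exists_in_out_of_mem_divergences (A := A) hβ' fun e he => (Multiset.mem_filter.1 he).2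
  set J : RootedGraph V := ⟨FA, I.p + P, I.q + Q, I.τ⟩
  have hdeg : ∀ B ⊆ A, J.deg B = I.deg B := by
    intro B hB
    simp only [deg, J, Pi.add_apply, Finset.sum_add_distrib]
    rw [← hF, cut_add, ← hcut B hB]
    ring
  have hJ : J.Admissible k A z := by
    refine ⟨⟨hFA, fun x => add_nonneg (h.p_nonneg x) (hP x),
      fun x => add_nonneg (h.q_nonneg x) (hQ x), ?_, ?_⟩, fun B hB hne hBA => ?_⟩
    · have h0 : ∑ x ∈ A, βA x = 0 :=
        sum_eq_zero_of_mem_divergences hβA' fun e he => by simp [hFA e he]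
      rw [← dvd_neg]
      refine hβA.trans (Eq.dvd ?_)
      simp only [J, demand, Pi.add_apply, Finset.sum_add_distrib, ← hPQ, Finset.sum_sub_distrib, h0]
      ring
    · rw [hdeg A subset_rfl]
      exact hs
    · unfold Balanced
      rw [hdeg B hB]
      exact h.splits B (hB.trans hA) hne fun hBW => hBA (hB.antisymm (hBW ▸ hA))
  obtain ⟨δ, hδ, hδτ⟩ := ih A (Finset.card_lt_card (hA.ssubset_of_ne hAW)) z J hJ
  refine ⟨δ + β', ?_, fun x hx => ?_⟩
  · rw [← hF]
    exact mem_divergences_add.2 ⟨δ, hδ, β', hβ', rfl⟩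
  · by_cases hxA : x ∈ A
    · refine (hδτ x hxA).trans (Eq.dvd ?_)
      simp only [J, Pi.add_apply, ← hPQ]
      ring
    · have h1 := hβW x hx hxA
      have h0 : ∀ ε ∈ divergences FA, ε x = 0 := fun ε hε =>
        apply_eq_zero_of_mem_divergences hε fun e he =>
          ⟨fun h => hxA (h ▸ (hFA e he).1), fun h => hxA (h ▸ (hFA e he).2)⟩
      rwa [Pi.add_apply, h0 βA hβA', ← h0 δ hδ, ← Pi.add_apply] at h1

/-- The multisets `F` and `(u, v) ::ₘ F'` agree up to reversing one edge. -/
def Detaches (F : Multiset (V × V)) (u v : V) (F' : Multiset (V × V)) : Prop :=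
  F = (u, v) ::ₘ F' ∨ F = (v, u) ::ₘ F'

namespace Detaches

variable {F F' : Multiset (V × V)} {u v : V}

omit [DecidableEq V] in
theorem exists_of_mem (h : (u, v) ∈ F ∨ (v, u) ∈ F) : ∃ F', Detaches F u v F' := by
  rcases h with h | h
  · obtain ⟨F', hF⟩ := Multiset.exists_cons_of_mem h
    exact ⟨F', .inl hF⟩
  · obtain ⟨F', hF⟩ := Multiset.exists_cons_of_mem h
    exact ⟨F', .inr hF⟩

omit [DecidableEq V] in
theorem card (h : Detaches F u v F') : F.card = F'.card + 1 := by
  rcases h with rfl | rfl <;> simp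

theorem cut_eq (h : Detaches F u v F') (A : Finset V) :
    cut F A = crossing A (u, v) + cut F' A := by
  rcases h with rfl | rfl
  · exact cut_cons ..
  · rw [cut_cons, ← crossing_swap, Prod.swap_prod_mk]

theorem divergences_eq (h : Detaches F u v F') :
    divergences F = divergences ((u, v) ::ₘ F') := by
  rcases h with rfl | rfl
  · rfl
  · rw [← divergences_swap_cons, Prod.swap_prod_mk]

omit [DecidableEq V] in
theorem forall_mem {W : Finset V} (h : Detaches F u v F')
    (hF : ∀ e ∈ F, e.1 ∈ W ∧ e.2 ∈ W) :
    u ∈ W ∧ v ∈ W ∧ ∀ e ∈ F', e.1 ∈ W ∧ e.2 ∈ W := by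
  rcases h with rfl | rfl <;> simp only [Multiset.mem_cons, forall_eq_or_imp] at hF <;>
    exact ⟨by tauto, by tauto, hF.2⟩

omit [DecidableEq V] in
theorem mem_of_mem (h : Detaches F u v F') {e : V × V} (he : e ∈ F) (h1 : e ≠ (u, v))
    (h2 : e ≠ (v, u)) : e ∈ F' := by
  rcases h with rfl | rfl <;> simp_all

end Detaches

theorem crossing_triangle (A : Finset V) (u v w : V) :
    crossing A (u, v) + crossing A (v, w) = crossing A (u, w) +
      if (u ∈ A ↔ w ∈ A) ∧ ¬(u ∈ A ↔ v ∈ A) then 2 else 0 := by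
  by_cases hu : u ∈ A <;> by_cases hv : v ∈ A <;> by_cases hw : w ∈ A <;>
    simp [crossing, hu, hv, hw]

variable (I) in
/-- All vertex sets apart from `v` have good splits, and edges at `v` may be split off. -/
structure Flexible (k : ℤ) (W : Finset V) (v : V) : Prop extends I.Consistent k W where
  vertex_mem : v ∈ W
  vertex : I.Balanced k {v} ∨ Splits k k (I.deg {v}) (I.demand {v})
  singleton : ∀ x ∈ W, x ≠ v → Splits k (k - 1) (I.deg {x}) (I.demand {x})
  splits : ∀ A ⊆ W, A ≠ W → 2 ≤ A.card → Splits k k (I.deg A) (I.demand A)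

theorem Flexible.reverse {v : V} (h : I.Flexible k W v) : I.reverse.Flexible k W v where
  toConsistent := h.toConsistent.reverse
  vertex_mem := h.vertex_mem
  vertex := by
    rw [reverse_deg, reverse_demand, splits_neg]
    exact h.vertex.imp_left fun h => h.reverse
  singleton x hx hxv := by
    rw [reverse_deg, reverse_demand, splits_neg]
    exact h.singleton x hx hxv
  splits A hA hAW hcard := by
    rw [reverse_deg, reverse_demand, splits_neg]
    exact h.splits A hA hAW hcard

omit [DecidableEq V] in
theorem singleton_or_two_le_card {A : Finset V} (hne : A.Nonempty) :
    (∃ x, A = {x}) ∨ 2 ≤ A.card := by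
  rw [← Finset.card_eq_one]
  have := hne.card_pos
  omega

theorem Flexible.admissible_of_deg {v : V} (h : I.Flexible k W v) {J : RootedGraph V}
    (hmem : ∀ e ∈ J.F, e.1 ∈ W ∧ e.2 ∈ W) (hp : ∀ x, 0 ≤ J.p x) (hq : ∀ x, 0 ≤ J.q x)
    (hτ : J.τ = I.τ)
    (hpq : ∑ x ∈ W, J.p x - ∑ x ∈ W, J.q x = ∑ x ∈ W, I.p x - ∑ x ∈ W, I.q x)
    (hW : J.deg W = I.deg W) (hdeg : ∀ A, J.deg A = I.deg A ∨ J.deg A = I.deg A - 2)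
    (hv : J.deg {v} = I.deg {v} - 2) (hx : ∀ x, x ≠ v → J.deg {x} = I.deg {x}) :
    J.Admissible k W v := by
  have hdem : ∀ A, J.demand A = I.demand A := fun A => by rw [demand, hτ, demand]
  refine ⟨⟨hmem, hp, hq, ?_, ?_⟩, fun A hA hne hAW => ?_⟩
  · refine h.dvd.trans (Eq.dvd ?_)
    rw [hdem]
    omega
  · rw [hW, hdem]
    exact h.not_splits
  · rw [hdem]
    obtain ⟨x, rfl⟩ | hcard := singleton_or_two_le_card hne
    · obtain rfl | hxv := eq_or_ne x v
      · obtain ⟨o, ho, hd⟩ | hs := h.vertex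
        · exact .inr ⟨rfl, o - 1, by omega, by rwa [hdem]⟩
        · exact .inl (hs.shift (-1) (-1) (by omega) (by simp) (by omega) (by omega))
      · rw [hx x hxv]
        exact .inl (h.singleton x (by simpa using hA) hxv)
    · have hs := h.splits A hA hAW hcard
      obtain h' | h' := hdeg A
      · exact .inl (hs.shift 0 0 (by omega) (by simp) (by omega) (by omega))
      · exact .inl (hs.shift (-1) (-1) (by omega) (by simp) (by omega) (by omega))

theorem Flexible.solvable_of_two_nbrs {u v w : V} (h : I.Flexible k W v)
    (ih : ∀ z (J : RootedGraph V), J.F.card < I.F.card → J.Admissible k W z → J.Solvable k W)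
    {F₁ F₂ : Multiset (V × V)} (h₁ : Detaches I.F u v F₁) (h₂ : Detaches F₁ v w F₂)
    (hu : u ≠ v) (hw : w ≠ v) (huw : u ≠ w) : I.Solvable k W := by
  obtain ⟨huW, hvW, hF₁⟩ := h₁.forall_mem h.mem
  obtain ⟨-, hwW, hF₂⟩ := h₂.forall_mem hF₁
  set J : RootedGraph V := ⟨(u, w) ::ₘ F₂, I.p, I.q, I.τ⟩
  have hdeg : ∀ A, I.deg A =
      J.deg A + if (u ∈ A ↔ w ∈ A) ∧ ¬(u ∈ A ↔ v ∈ A) then 2 else 0 := by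
    intro A
    simp only [deg, J]
    rw [h₁.cut_eq, h₂.cut_eq, cut_cons]
    linarith [crossing_triangle A u v w]
  have hJ : J.Admissible k W v := by
    refine h.admissible_of_deg ?_ h.p_nonneg h.q_nonneg rfl rfl ?_ ?_ ?_ ?_
    · simpa [J, huW, hwW] using hF₂
    · have := hdeg W
      simp_all
    · intro A
      have := hdeg A
      split_ifs at this <;> omega
    · have := hdeg {v}
      simp_all
    · intro x hx
      have := hdeg {x}
      rw [if_neg] at this
      · omega
      · simp only [Finset.mem_singleton]
        grind
  have hcard : J.F.card < I.F.card := by simp [J, h₁.card, h₂.card]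
  obtain ⟨β, hβ, hβτ⟩ := ih v J hcard hJ
  refine ⟨β, ?_, hβτ⟩
  rw [h₁.divergences_eq]
  have := divergences_lift_subset u v w F₂ hβ
  obtain ⟨γ, hγ, hβγ⟩ := mem_divergences_cons.1 this
  exact mem_divergences_cons.2 ⟨γ, h₂.divergences_eq ▸ hγ, hβγ⟩

theorem Flexible.solvable_of_p_pos {u v : V} (h : I.Flexible k W v)
    (ih : ∀ z (J : RootedGraph V), J.F.card < I.F.card → J.Admissible k W z → J.Solvable k W)
    {F' : Multiset (V × V)} (h' : Detaches I.F v u F') (hu : u ≠ v) (hp : 0 < I.p v) :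
    I.Solvable k W := by
  obtain ⟨hvW, huW, hF'⟩ := h'.forall_mem h.mem
  set J : RootedGraph V := ⟨F', I.p + Pi.single u 1 - Pi.single v 1, I.q, I.τ⟩
  have hdeg : ∀ A, J.deg A = I.deg A +
      ((if u ∈ A then 1 else 0) - (if v ∈ A then 1 else 0) - crossing A (v, u)) := by
    intro A
    simp only [deg, J, Pi.add_apply, Pi.sub_apply, Finset.sum_add_distrib, Finset.sum_sub_distrib,
      Finset.sum_pi_single', h'.cut_eq A]
    ring
  have hJ : J.Admissible k W v := by
    refine h.admissible_of_deg hF' ?_ h.q_nonneg rfl ?_ ?_ ?_ ?_ ?_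
    · intro x
      have := h.p_nonneg x
      simp only [J, Pi.add_apply, Pi.sub_apply, Pi.single_apply]
      split_ifs <;> simp_all <;> omega
    · simp [J, Finset.sum_add_distrib, huW, hvW]
    · simp [hdeg W, crossing, huW, hvW]
    · intro A
      rw [hdeg A]
      by_cases h1 : u ∈ A <;> by_cases h2 : v ∈ A <;> simp [crossing, h1, h2]
      omega
    · simp [hdeg, crossing, hu]
      omega
    · intro x hx
      rw [hdeg]
      by_cases h1 : u = x <;> simp [crossing, h1, hx.symm]
  obtain ⟨β, hβ, hβτ⟩ := ih v J (by simp [J, h'.card]) hJ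
  refine ⟨edgeFlow (v, u) + β, ?_, fun x hx => (hβτ x hx).trans (Eq.dvd ?_)⟩
  · rw [h'.divergences_eq]
    exact mem_divergences_cons.2 ⟨β, hβ, .inl rfl⟩
  · simp only [J, edgeFlow, Pi.add_apply, Pi.sub_apply]
    ring

theorem Flexible.splits_of_ne {v : V} (h : I.Flexible k W v) {A : Finset V}
    (hA : A ⊆ W) (hne : A.Nonempty) (hAW : A ≠ W) (hv : A ≠ {v}) :
    Splits k (k - 1) (I.deg A) (I.demand A) := by
  obtain ⟨x, rfl⟩ | hcard := singleton_or_two_le_card hne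
  · exact h.singleton x (by simpa using hA) (by simpa using hv)
  · exact (h.splits A hA hAW hcard).mono (by omega)

theorem Flexible.solvable_of_pendant {u v : V} (h : I.Flexible k W v) (hk : 0 < k)
    (ih : ∀ W' : Finset V, W'.card < W.card → ∀ z (I : RootedGraph V),
      I.Admissible k W' z → I.Solvable k W')
    (huW : u ∈ W) (hu : u ≠ v) (hp : I.p v = 0) (hq : I.q v = 0)
    (hF : ∀ e ∈ I.F, e.1 = v ∨ e.2 = v → e = (v, v) ∨ e = (v, u) ∨ e = (u, v)) :
    I.Solvable k W := by
  have hvW := h.vertex_mem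
  set Fv := I.F.filter fun e => e.1 = v ∨ e.2 = v
  set F' := I.F.filter fun e => ¬(e.1 = v ∨ e.2 = v)
  have hsum : Fv + F' = I.F := Multiset.filter_add_not _ _
  have hFv : ∀ e ∈ Fv, e = (v, v) ∨ e = (v, u) ∨ e = (u, v) := fun e he =>
    hF e (Multiset.mem_filter.1 he).1 (Multiset.mem_filter.1 he).2
  have hF' : ∀ e ∈ F', (e.1 ∈ W ∧ e.2 ∈ W) ∧ e.1 ≠ v ∧ e.2 ≠ v := fun e he =>
    ⟨h.mem e (Multiset.mem_filter.1 he).1, not_or.1 (Multiset.mem_filter.1 he).2⟩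
  have hdegv : I.deg {v} = cut Fv {v} := by
    rw [deg, ← hsum, cut_add, cut_eq_zero (F := F') fun e he => by simp [hF' e he]]
    simp [hp, hq]
  obtain ⟨o, n, hon, hd, ho, hn⟩ : ∃ o n, o + n = I.deg {v} ∧ 2 * k ∣ o - n - I.demand {v} ∧
      0 ≤ o ∧ 0 ≤ n := by
    obtain ⟨o, ho, hd⟩ | hs := h.vertex
    · have := cut_nonneg Fv {v}
      exact ⟨o, o, by omega, by simpa using hd, by omega, by omega⟩
    · exact hs.mono hk.le
  set J : RootedGraph V := ⟨F', I.p, I.q, I.τ + Pi.single u (o - n)⟩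
  have hdeg : ∀ B ⊆ W.erase v, u ∉ B → J.deg B = I.deg B := by
    intro B hB huB
    have hvB : v ∉ B := fun hv => by simpa using hB hv
    simp only [deg, J]
    rw [← hsum, cut_add, cut_eq_zero (F := Fv), zero_add]
    intro e he
    rcases hFv e he with rfl | rfl | rfl <;> simp [huB, hvB]
  have hdegu : ∀ B ⊆ W.erase v, u ∈ B → J.deg B = I.deg (insert v B) := by
    intro B hB huB
    have hvB : v ∉ B := fun hv => by simpa using hB hv
    simp only [deg, J]
    rw [← hsum, cut_add, cut_eq_zero (F := Fv), zero_add, Finset.sum_insert hvB,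
      Finset.sum_insert hvB, hp, hq, zero_add, zero_add, cut_congr (F := F')]
    · intro e he
      simp [hF' e he]
    · intro e he
      rcases hFv e he with rfl | rfl | rfl <;> simp [huB]
  have hdem : ∀ B, u ∉ B → J.demand B = I.demand B := by
    intro B huB
    simp [demand, J, Finset.sum_add_distrib, huB]
  have hdemu : ∀ B ⊆ W.erase v, u ∈ B →
      J.demand B = I.demand (insert v B) + (o - n - I.demand {v}) := by
    intro B hB huB
    have hvB : v ∉ B := fun hv => by simpa using hB hv
    simp only [demand, J, Pi.add_apply, Finset.sum_add_distrib, Finset.sum_pi_single', huB,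
      if_true, Finset.sum_insert hvB, Finset.sum_singleton]
    ring
  have huv : u ∈ W.erase v := Finset.mem_erase.2 ⟨hu, huW⟩
  have hins : insert v (W.erase v) = W := Finset.insert_erase hvW
  have hJ : J.Admissible k (W.erase v) v := by
    refine ⟨⟨?_, h.p_nonneg, h.q_nonneg, ?_, ?_⟩, fun B hB hne hBW => .inl ?_⟩
    · intro e he
      have := hF' e he
      simp [this]
    · have h1 := Finset.sum_erase_add W I.p hvW
      have h2 := Finset.sum_erase_add W I.q hvW
      refine (dvd_add h.dvd hd).trans (Eq.dvd ?_)
      rw [hdemu _ subset_rfl huv, hins, ← h1, ← h2, hp, hq]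
      ring
    · intro hs
      rw [hdegu _ subset_rfl huv, hdemu _ subset_rfl huv, hins] at hs
      exact h.not_splits (hs.shift 0 0 (by ring) (by simpa using hd) (by simp) (by simp))
    · by_cases huB : u ∈ B
      · have hs := h.splits_of_ne (A := insert v B)
          (by rw [← hins]; exact Finset.insert_subset_insert v hB) (Finset.insert_nonempty _ _)
          (fun hBW' => hBW (by
            rw [← hBW', Finset.erase_insert fun hv => by simpa using hB hv]))
          (fun hBv => hu (Finset.mem_singleton.1 (hBv ▸ Finset.mem_insert_of_mem huB)))
        rw [hdegu B hB huB, hdemu B hB huB]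
        refine hs.shift 0 0 (by ring) ?_ (by simp) (by simp)
        rw [← dvd_neg]
        exact hd.trans (Eq.dvd (by ring))
      · rw [hdeg B hB huB, hdem B huB]
        exact h.splits_of_ne (hB.trans (Finset.erase_subset _ _)) hne
          (fun hBW => huB (hBW ▸ huW)) (fun hBv => by simp [hBv] at hB)
  obtain ⟨β, hβ, hβτ⟩ := ih _ (Finset.card_erase_lt_of_mem hvW) v J hJ
  refine ⟨(o - n) • edgeFlow (v, u) + β, ?_, fun x hx => ?_⟩
  · rw [← hsum]
    exact mem_divergences_add.2 ⟨_, smul_edgeFlow_mem_divergences hu hFv ho hn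
      (hon.trans hdegv), β, hβ, rfl⟩
  · obtain rfl | hxv := eq_or_ne x v
    · have h0 : β x = 0 := apply_eq_zero_of_mem_divergences hβ fun e he => (hF' e he).2
      refine hd.trans (Eq.dvd ?_)
      simp [edgeFlow, hp, hq, h0, demand, hu.symm]
    · refine (hβτ x (Finset.mem_erase.2 ⟨hxv, hx⟩)).trans (Eq.dvd ?_)
      obtain rfl | hxu := eq_or_ne x u
      · simp_all [edgeFlow, J]
        ring
      · simp_all [edgeFlow, J]

theorem Flexible.p_q_eq_zero_of_isolated {v : V} (h : I.Flexible k W v) (hk : 0 < k)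
    (hcard : 2 ≤ W.card) (hF : ∀ e ∈ I.F, e.1 = v ↔ e.2 = v) : I.p v = 0 ∧ I.q v = 0 := by
  have hcut : cut I.F {v} = 0 := cut_eq_zero fun e he => by simpa using hF e he
  have hdeg : I.deg {v} = I.p v + I.q v := by simp [deg, hcut]
  have hp := h.p_nonneg v
  have hq := h.q_nonneg v
  by_contra hpq
  have hv : Splits k 1 (I.deg {v}) (I.demand {v}) := by
    obtain ⟨o, ho, hd⟩ | hs := h.vertex
    · exact ⟨o, o, by omega, by simpa using hd, by omega, by omega⟩
    · exact hs.mono hk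
  have hvW := Finset.singleton_subset_iff.2 h.vertex_mem
  have hc := Finset.card_sdiff_add_card_eq_card hvW
  rw [Finset.card_singleton] at hc
  refine h.not_splits_compl hvW hcut (j' := k - 1) (by omega) hv
    (h.splits_of_ne Finset.sdiff_subset (Finset.card_pos.1 (by omega)) ?_ ?_)
  · intro he
    rw [he] at hc
    omega
  · intro he
    have : v ∈ W \ {v} := by rw [he]; exact Finset.mem_singleton_self v
    simp at this

theorem Flexible.solvable {v : V} (h : I.Flexible k W v) (hk : 0 < k) (hcard : 2 ≤ W.card)
    (ihW : ∀ W' : Finset V, W'.card < W.card → ∀ z (I : RootedGraph V),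
      I.Admissible k W' z → I.Solvable k W')
    (ih : ∀ z (J : RootedGraph V), J.F.card < I.F.card → J.Admissible k W z → J.Solvable k W) :
    I.Solvable k W := by
  by_cases hnb : ∃ u, u ≠ v ∧ ((v, u) ∈ I.F ∨ (u, v) ∈ I.F)
  · obtain ⟨u, hu, huF⟩ := hnb
    obtain ⟨F', hF'⟩ := Detaches.exists_of_mem huF
    by_cases hp : 0 < I.p v
    · exact h.solvable_of_p_pos ih hF' hu hp
    by_cases hq : 0 < I.q v
    · exact solvable_reverse.1 (h.reverse.solvable_of_p_pos ih hF' hu hq)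
    by_cases hw : ∃ w, w ≠ v ∧ w ≠ u ∧ ((v, w) ∈ I.F ∨ (w, v) ∈ I.F)
    · obtain ⟨w, hwv, hwu, hwF⟩ := hw
      obtain ⟨F₁, hF₁⟩ := Detaches.exists_of_mem huF.symm
      obtain ⟨F₂, hF₂⟩ := Detaches.exists_of_mem (F := F₁) (u := v) (v := w)
        (hwF.imp (fun h => hF₁.mem_of_mem h (by simp [hu.symm]) (by simp [hwu]))
          (fun h => hF₁.mem_of_mem h (by simp [hwu]) (by simp [hwv])))
      exact h.solvable_of_two_nbrs ih hF₁ hF₂ hu hwv hwu.symm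
    · have hp0 := h.p_nonneg v
      have hq0 := h.q_nonneg v
      refine h.solvable_of_pendant hk ihW (hF'.forall_mem h.mem).2.1 hu (by omega) (by omega) ?_
      rintro ⟨x, y⟩ he (rfl | rfl)
      · by_cases hyx : y = x
        · exact .inl (by rw [hyx])
        by_cases hyu : y = u
        · exact .inr (.inl (by rw [hyu]))
        exact absurd ⟨y, hyx, hyu, .inl he⟩ hw
      · by_cases hyx : x = y
        · exact .inl (by rw [hyx])
        by_cases hyu : x = u
        · exact .inr (.inr (by rw [hyu]))
        exact absurd ⟨x, hyx, hyu, .inr he⟩ hw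
  · have hiso : ∀ e ∈ I.F, e.1 = v ↔ e.2 = v := by
      rintro ⟨x, y⟩ he
      constructor
      · rintro rfl
        by_contra hy
        exact hnb ⟨y, hy, .inl he⟩
      · rintro rfl
        by_contra hx
        exact hnb ⟨x, hx, .inr he⟩
    obtain ⟨hp, hq⟩ := h.p_q_eq_zero_of_isolated hk hcard hiso
    obtain ⟨u, hu, huv⟩ := Finset.exists_mem_ne (s := W) (by omega) v
    refine h.solvable_of_pendant hk ihW hu huv hp hq ?_
    rintro ⟨x, y⟩ he h'
    have := hiso _ he
    exact .inl (by simp_all)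

variable (I) in
/-- The split of `{x}` has exactly `k - 1` ingoing edges, but at least `k` outgoing ones. -/
def Positive (k : ℤ) (x : V) : Prop :=
  ∃ o, k ≤ o ∧ o + (k - 1) = I.deg {x} ∧ 2 * k ∣ o - (k - 1) - I.demand {x}

theorem Positive.splits {x : V} (h : I.Positive k x) :
    Splits k (k - 1) (I.deg {x} - 1) (I.demand {x} - 1) := by
  obtain ⟨o, ho, hdeg, hd⟩ := h
  exact ⟨o - 1, k - 1, by omega, hd.trans (Eq.dvd (by ring)), by omega, le_rfl⟩

theorem Positive.splits_of_reverse {x : V} (h : I.reverse.Positive k x) :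
    Splits k (k - 1) (I.deg {x} - 1) (I.demand {x} + 1) := by
  have := h.splits.neg
  rwa [reverse_deg, reverse_demand, neg_sub, sub_neg_eq_add, add_comm] at this

variable (I) in
/-- All larger sets have a flexible split, but no vertex has one. -/
structure Rigid (k : ℤ) (W : Finset V) : Prop extends I.Consistent k W where
  singleton : ∀ x ∈ W, Splits k (k - 1) (I.deg {x}) (I.demand {x})
  splits : ∀ A ⊆ W, A ≠ W → 2 ≤ A.card → Splits k k (I.deg A) (I.demand A)
  not_balanced : ∀ x ∈ W, ¬ I.Balanced k {x}
  not_splits_singleton : ∀ x ∈ W, ¬ Splits k k (I.deg {x}) (I.demand {x})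

theorem Rigid.reverse (h : I.Rigid k W) : I.reverse.Rigid k W where
  toConsistent := h.toConsistent.reverse
  singleton x hx := by
    rw [reverse_deg, reverse_demand, splits_neg]
    exact h.singleton x hx
  splits A hA hAW hcard := by
    rw [reverse_deg, reverse_demand, splits_neg]
    exact h.splits A hA hAW hcard
  not_balanced x hx hb := h.not_balanced x hx (by simpa [reverse_reverse] using hb.reverse)
  not_splits_singleton x hx := by
    rw [reverse_deg, reverse_demand, splits_neg]
    exact h.not_splits_singleton x hx

theorem Rigid.positive_or_positive_reverse (h : I.Rigid k W) {x : V} (hx : x ∈ W) :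
    I.Positive k x ∨ I.reverse.Positive k x := by
  obtain ⟨o, n, hon, hd, ho, hn⟩ := h.singleton x hx
  by_cases hn' : k ≤ n
  · by_cases ho' : k ≤ o
    · exact absurd ⟨o, n, hon, hd, ho', hn'⟩ (h.not_splits_singleton x hx)
    · obtain rfl : o = k - 1 := by omega
      refine .inr ⟨n, hn', by rw [reverse_deg]; omega, ?_⟩
      rw [reverse_demand, ← dvd_neg]
      exact hd.trans (Eq.dvd (by ring))
  · obtain rfl : n = k - 1 := by omega
    by_cases ho' : k ≤ o
    · exact .inl ⟨o, ho', hon, hd⟩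
    · obtain rfl : o = k - 1 := by omega
      exact absurd ⟨k - 1, by omega, by simpa using hd⟩ (h.not_balanced x hx)

theorem Rigid.cut_ne_zero (h : I.Rigid k W) (hk : 2 ≤ k) {A : Finset V} (hA : A ⊆ W)
    (hne : A.Nonempty) (hAW : A ≠ W) : cut I.F A ≠ 0 := by
  have key : ∀ A ⊆ W, A.Nonempty → A ≠ W → Splits k (k - 1) (I.deg A) (I.demand A) := by
    intro A hA hne hAW
    obtain ⟨x, rfl⟩ | hcard := singleton_or_two_le_card hne
    · exact h.singleton x (by simpa using hA)
    · exact (h.splits A hA hAW hcard).mono (by omega)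
  refine fun hcut => h.not_splits_compl hA hcut (by omega) (key A hA hne hAW)
    (key (W \ A) Finset.sdiff_subset ?_ ?_)
  · exact Finset.sdiff_nonempty.2 fun h => hAW (hA.antisymm h)
  · intro h
    obtain ⟨x, hx⟩ := hne
    exact (Finset.mem_sdiff.1 (h.symm ▸ hA hx)).2 hx

/-- Orient and delete an edge from a positive to a negative vertex. -/
theorem Rigid.solvable_of_edge {x y : V} (h : I.Rigid k W)
    (ih : ∀ z (J : RootedGraph V), J.F.card < I.F.card → J.Admissible k W z → J.Solvable k W)
    (hx : I.Positive k x) (hy : I.reverse.Positive k y) (hxy : x ≠ y) {F' : Multiset (V × V)}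
    (hF' : Detaches I.F x y F') : I.Solvable k W := by
  obtain ⟨hxW, hyW, hmem⟩ := hF'.forall_mem h.mem
  set J : RootedGraph V := ⟨F', I.p, I.q, I.τ - Pi.single x 1 + Pi.single y 1⟩
  have hdeg : ∀ A, J.deg A = I.deg A - crossing A (x, y) := by
    intro A
    simp only [deg, J, hF'.cut_eq A]
    ring
  have hdem : ∀ A, J.demand A =
      I.demand A - (if x ∈ A then 1 else 0) + (if y ∈ A then 1 else 0) := by
    intro A
    simp [demand, J, Finset.sum_add_distrib]
  have hW : J.deg W = I.deg W := by simp [hdeg, crossing, hxW, hyW]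
  have hW' : J.demand W = I.demand W := by simp [hdem, hxW, hyW]
  have hJ : J.Admissible k W x := by
    refine ⟨⟨hmem, h.p_nonneg, h.q_nonneg, by rw [hW']; exact h.dvd,
      by rw [hW, hW']; exact h.not_splits⟩, fun A hA hne hAW => .inl ?_⟩
    rw [hdeg, hdem]
    obtain ⟨t, rfl⟩ | hcard := singleton_or_two_le_card hne
    · obtain rfl | htx := eq_or_ne t x
      · simpa [crossing, hxy.symm] using hx.splits
      obtain rfl | hty := eq_or_ne t y
      · simpa [crossing, hxy] using hy.splits_of_reverse
      · simpa [crossing, htx.symm, hty.symm] using h.singleton t (by simpa using hA)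
    · have hs := h.splits A hA hAW hcard
      by_cases h1 : x ∈ A <;> by_cases h2 : y ∈ A <;>
        simp only [crossing, h1, h2, if_true, if_false]
      · exact hs.shift 0 0 (by simp) (by simp) (by omega) (by omega)
      · exact hs.shift (-1) 0 (by simp; ring) (by ring_nf; simp) (by omega) (by omega)
      · exact hs.shift 0 (-1) (by simp; ring) (by ring_nf; simp) (by omega) (by omega)
      · exact hs.shift 0 0 (by simp) (by simp) (by omega) (by omega)
  obtain ⟨β, hβ, hβτ⟩ := ih x J (by simp [J, hF'.card]) hJ
  refine ⟨edgeFlow (x, y) + β, ?_, fun t ht => (hβτ t ht).trans (Eq.dvd ?_)⟩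
  · rw [hF'.divergences_eq]
    exact mem_divergences_cons.2 ⟨β, hβ, .inl rfl⟩
  · simp only [J, edgeFlow, Pi.add_apply, Pi.sub_apply]
    ring

/-- Delete an edge from a positive vertex to the root. -/
theorem Rigid.solvable_of_q_pos {x : V} (h : I.Rigid k W)
    (ih : ∀ z (J : RootedGraph V), J.F.card = I.F.card →
      ∑ x ∈ W, J.p x + ∑ x ∈ W, J.q x < ∑ x ∈ W, I.p x + ∑ x ∈ W, I.q x →
      J.Admissible k W z → J.Solvable k W)
    (hxW : x ∈ W) (hx : I.Positive k x) (hq : 0 < I.q x) : I.Solvable k W := by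
  set J : RootedGraph V := ⟨I.F, I.p, I.q - Pi.single x 1, I.τ - Pi.single x 1⟩
  have hdeg : ∀ A, J.deg A = I.deg A - if x ∈ A then 1 else 0 := by
    intro A
    simp only [deg, J, Pi.sub_apply, Finset.sum_sub_distrib, Finset.sum_pi_single']
    ring
  have hdem : ∀ A, J.demand A = I.demand A - if x ∈ A then 1 else 0 := by
    intro A
    simp [demand, J]
  have hJ : J.Admissible k W x := by
    refine ⟨⟨h.mem, h.p_nonneg, fun t => ?_, ?_, fun hs => ?_⟩, fun A hA hne hAW => .inl ?_⟩
    · have := h.q_nonneg t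
      simp only [J, Pi.sub_apply, Pi.single_apply]
      split_ifs with htx
      · subst htx
        omega
      · omega
    · refine h.dvd.trans (Eq.dvd ?_)
      simp [hdem, J, hxW]
    · rw [hdeg, hdem] at hs
      exact h.not_splits (hs.shift 1 0 (by simp [hxW]) (by simp [hxW]) (by simp) (by simp))
    rw [hdeg, hdem]
    obtain ⟨t, rfl⟩ | hcard := singleton_or_two_le_card hne
    · obtain rfl | htx := eq_or_ne t x
      · simpa using hx.splits
      · simpa [htx.symm] using h.singleton t (by simpa using hA)
    · have hs := h.splits A hA hAW hcard
      split_ifs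
      · exact hs.shift (-1) 0 (by ring) (by ring_nf; simp) (by omega) (by omega)
      · exact hs.shift 0 0 (by simp) (by simp) (by omega) (by omega)
  obtain ⟨β, hβ, hβτ⟩ := ih x J rfl (by simp [J, hxW]) hJ
  refine ⟨β, hβ, fun t ht => (hβτ t ht).trans (Eq.dvd ?_)⟩
  simp only [J, Pi.sub_apply]
  ring

/-- If all vertices are positive, orient and delete an edge after adding edges to the root. -/
theorem Rigid.solvable_of_forall_positive (h : I.Rigid k W) (hk : 2 ≤ k) (hcard : 2 ≤ W.card)
    (ih : ∀ z (J : RootedGraph V), J.F.card < I.F.card → J.Admissible k W z → J.Solvable k W)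
    (hpos : ∀ x ∈ W, I.Positive k x) (hq : ∀ x ∈ W, I.q x = 0) : I.Solvable k W := by
  obtain ⟨x, y, hxy, he⟩ : ∃ x y, x ≠ y ∧ (x, y) ∈ I.F := by
    by_contra! hF
    obtain ⟨x, hx⟩ : W.Nonempty := Finset.card_pos.1 (by omega)
    refine h.cut_ne_zero hk (Finset.singleton_subset_iff.2 hx) (Finset.singleton_nonempty x) ?_
      (cut_eq_zero fun e he => ?_)
    · rintro rfl
      simp at hcard
    · have : e.1 = e.2 := by_contra fun hne => hF _ _ hne he
      rw [this]
  obtain ⟨F', hF'⟩ := Detaches.exists_of_mem (.inl he)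
  obtain ⟨hxW, hyW, hmem⟩ := hF'.forall_mem h.mem
  obtain ⟨o, ho, hodeg, hod⟩ := hpos x hxW
  have ho' : o ≤ 2 * k - 1 := by
    by_contra hlt
    exact h.not_splits_singleton x hxW ⟨o - k, k - 1 + k, by omega,
      (dvd_sub_self_right.2 hod).trans (Eq.dvd (by ring)), by omega, by omega⟩
  set ι := 2 * k - 1 - o with hι
  set J : RootedGraph V :=
    ⟨F', I.p, I.q + Pi.single x ι, I.τ + Pi.single x (1 + ι) - Pi.single y 1⟩
  have hdeg : ∀ A, J.deg A = I.deg A - crossing A (x, y) + if x ∈ A then ι else 0 := by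
    intro A
    simp only [deg, J, Pi.add_apply, Finset.sum_add_distrib, Finset.sum_pi_single', hF'.cut_eq A]
    ring
  have hdem : ∀ A, J.demand A =
      I.demand A + (if x ∈ A then 1 + ι else 0) - (if y ∈ A then 1 else 0) := by
    intro A
    simp [demand, J, Finset.sum_add_distrib]
  have hW : J.deg W = I.deg W + ι := by simp [hdeg, crossing, hxW, hyW]
  have hW' : J.demand W = I.demand W + ι := by
    simp only [hdem, hxW, hyW, if_true]
    ring
  have hqW : ∑ x ∈ W, I.q x = 0 := Finset.sum_eq_zero hq
  have hJ : J.Admissible k W x := by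
    refine ⟨⟨hmem, h.p_nonneg, fun t => ?_, ?_, ?_⟩, fun A hA hne hAW => .inl ?_⟩
    · refine add_nonneg (h.q_nonneg t) ?_
      rw [Pi.single_apply]
      split_ifs <;> omega
    · refine h.dvd.trans (Eq.dvd ?_)
      simp [hW', J, Finset.sum_add_distrib, hxW]
    · rw [hW, hW']
      rintro ⟨o', n', hon, hd, ho', hn'⟩
      have hdW := h.deg_self
      have hdvd := h.dvd
      rw [hqW] at hdW hdvd
      have h2 : 2 * k ∣ 2 * (o' - ι) := by
        refine (dvd_add hd hdvd).trans (Eq.dvd ?_)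
        linarith
      have h3 : k ≤ o' - ι :=
        Int.le_of_dvd (by omega) ((mul_dvd_mul_iff_left two_ne_zero).1 h2)
      exact h.not_splits ⟨o' - ι, n', by omega, hd.trans (Eq.dvd (by ring)), h3, hn'⟩
    rw [hdeg, hdem]
    obtain ⟨t, rfl⟩ | hcard := singleton_or_two_le_card hne
    · obtain rfl | htx := eq_or_ne t x
      · refine ⟨k - 1, 2 * k - 2, ?_, ?_, le_rfl, by omega⟩
        · simp [crossing, hxy.symm]
          omega
        · simp only [Finset.mem_singleton, hxy.symm, if_true, if_false]
          refine (dvd_sub_self_right.2 hod).trans (Eq.dvd ?_)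
          rw [hι]
          ring
      obtain rfl | hty := eq_or_ne t y
      · simpa [crossing, hxy] using (hpos t hyW).splits
      · simpa [crossing, htx.symm, hty.symm] using h.singleton t (by simpa using hA)
    · have hs := h.splits A hA hAW hcard
      by_cases h1 : x ∈ A <;> by_cases h2 : y ∈ A <;>
        simp only [crossing, h1, h2, if_true, if_false]
      · exact hs.shift ι 0 (by simp) (by ring_nf; simp) (by omega) (by omega)
      · exact hs.shift ι (-1) (by simp; ring) (by ring_nf; simp) (by omega) (by omega)
      · exact hs.shift (-1) 0 (by simp; ring) (by ring_nf; simp) (by omega) (by omega)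
      · exact hs.shift 0 0 (by simp) (by simp) (by omega) (by omega)
  obtain ⟨β, hβ, hβτ⟩ := ih x J (by simp [J, hF'.card]) hJ
  refine ⟨-edgeFlow (x, y) + β, ?_, fun t ht => (hβτ t ht).trans (Eq.dvd ?_)⟩
  · rw [hF'.divergences_eq]
    exact mem_divergences_cons.2 ⟨β, hβ, .inr rfl⟩
  · simp only [J, edgeFlow, Pi.add_apply, Pi.sub_apply, Pi.neg_apply, Pi.single_apply]
    split_ifs <;> ring

theorem Rigid.solvable (h : I.Rigid k W) (hk : 2 ≤ k) (hcard : 2 ≤ W.card)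
    (ihF : ∀ z (J : RootedGraph V), J.F.card < I.F.card → J.Admissible k W z → J.Solvable k W)
    (ih : ∀ z (J : RootedGraph V), J.F.card = I.F.card →
      ∑ x ∈ W, J.p x + ∑ x ∈ W, J.q x < ∑ x ∈ W, I.p x + ∑ x ∈ W, I.q x →
      J.Admissible k W z → J.Solvable k W) : I.Solvable k W := by
  classical
  by_cases hq : ∃ x ∈ W, I.Positive k x ∧ 0 < I.q x
  · obtain ⟨x, hxW, hx, hqx⟩ := hq
    exact h.solvable_of_q_pos ih hxW hx hqx
  by_cases hp : ∃ x ∈ W, I.reverse.Positive k x ∧ 0 < I.p x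
  · obtain ⟨x, hxW, hx, hpx⟩ := hp
    exact solvable_reverse.1 (h.reverse.solvable_of_q_pos
      (fun z J h1 h2 => ih z J h1 (h2.trans_eq (add_comm _ _))) hxW hx hpx)
  by_cases hpos : ∀ x ∈ W, I.Positive k x
  · refine h.solvable_of_forall_positive hk hcard ihF hpos fun x hx => ?_
    exact (h.q_nonneg x).antisymm' (not_lt.1 fun hlt => hq ⟨x, hx, hpos x hx, hlt⟩)
  by_cases hneg : ∀ x ∈ W, I.reverse.Positive k x
  · refine solvable_reverse.1 (h.reverse.solvable_of_forall_positive hk hcard ihF hneg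
      fun x hx => ?_)
    exact (h.p_nonneg x).antisymm' (not_lt.1 fun hlt => hp ⟨x, hx, hneg x hx, hlt⟩)
  push Not at hpos hneg
  obtain ⟨a, haW, ha⟩ := hpos
  obtain ⟨b, hbW, hb⟩ := hneg
  set A := {x ∈ W | I.Positive k x} with hA
  have hbA : b ∈ A :=
    Finset.mem_filter.2 ⟨hbW, (h.positive_or_positive_reverse hbW).resolve_right hb⟩
  have hcut := h.cut_ne_zero hk (Finset.filter_subset _ _) ⟨b, hbA⟩
    (fun hAW => ha (Finset.mem_filter.1 (by rwa [hAW] : a ∈ {x ∈ W | I.Positive k x})).2)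
  obtain ⟨x, y, hxA, hyW, hyA, hxy⟩ : ∃ x y, x ∈ A ∧ y ∈ W ∧ y ∉ A ∧
      ((x, y) ∈ I.F ∨ (y, x) ∈ I.F) := by
    by_contra! hno
    refine hcut (cut_eq_zero ?_)
    rintro ⟨x, y⟩ he
    have hm := h.mem _ he
    constructor
    · intro hx
      by_contra hy
      exact (hno x y hx hm.2 hy).1 he
    · intro hy
      by_contra hx
      exact (hno y x hy hm.1 hx).2 he
  obtain ⟨F', hF'⟩ := Detaches.exists_of_mem hxy
  have hy : I.reverse.Positive k y := (h.positive_or_positive_reverse hyW).resolve_left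
    fun h => hyA (Finset.mem_filter.2 ⟨hyW, h⟩)
  exact h.solvable_of_edge ihF (Finset.mem_filter.1 hxA).2 hy (fun h => hyA (h ▸ hxA)) hF'

/-- The orientation theorem for rooted graphs, with one step of the induction. -/
theorem Admissible.solvable_of_smaller (h : I.Admissible k W z) (hk : 2 ≤ k)
    (ihW : ∀ W' : Finset V, W'.card < W.card → ∀ z (I : RootedGraph V),
      I.Admissible k W' z → I.Solvable k W')
    (ihF : ∀ z (J : RootedGraph V), J.F.card < I.F.card → J.Admissible k W z → J.Solvable k W)
    (ih : ∀ z (J : RootedGraph V), J.F.card = I.F.card →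
      ∑ x ∈ W, J.p x + ∑ x ∈ W, J.q x < ∑ x ∈ W, I.p x + ∑ x ∈ W, I.q x →
      J.Admissible k W z → J.Solvable k W) : I.Solvable k W := by
  by_cases hcard : W.card ≤ 1
  · exact h.solvable_of_card_le_one hcard
  replace hcard : 2 ≤ W.card := by omega
  by_cases hbig : ∀ A ⊆ W, A ≠ W → 2 ≤ A.card → Splits k k (I.deg A) (I.demand A)
  swap
  · push Not at hbig
    obtain ⟨A, hA, hAW, hA2, hs⟩ := hbig
    exact h.solvable_of_tight ihW hA hAW hA2 hs
  have hone : ∀ x ∈ W, Splits k (k - 1) (I.deg {x}) (I.demand {x}) ∨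
      x = z ∧ I.Balanced k {x} := fun x hx =>
    (h.splits {x} (Finset.singleton_subset_iff.2 hx) (Finset.singleton_nonempty x)
      (by rintro rfl; simp at hcard)).imp_right fun h => ⟨Finset.singleton_injective h.1, h.2⟩
  by_cases hz : z ∈ W ∧ I.Balanced k {z}
  · have hflex : I.Flexible k W z := ⟨h.toConsistent, hz.1, .inl hz.2,
      fun x hx hxz => (hone x hx).resolve_right fun h => hxz h.1, hbig⟩
    exact hflex.solvable (by omega) hcard ihW ihF
  have hone' : ∀ x ∈ W, Splits k (k - 1) (I.deg {x}) (I.demand {x}) := fun x hx =>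
    (hone x hx).resolve_right fun h => hz ⟨h.1 ▸ hx, h.1 ▸ h.2⟩
  by_cases hv : ∃ v ∈ W, I.Balanced k {v} ∨ Splits k k (I.deg {v}) (I.demand {v})
  · obtain ⟨v, hvW, hv⟩ := hv
    have hflex : I.Flexible k W v :=
      ⟨h.toConsistent, hvW, hv, fun x hx _ => hone' x hx, hbig⟩
    exact hflex.solvable (by omega) hcard ihW ihF
  · have hrig : I.Rigid k W := ⟨h.toConsistent, hone', hbig,
      fun x hx hb => hv ⟨x, hx, .inl hb⟩, fun x hx hs => hv ⟨x, hx, .inr hs⟩⟩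
    exact hrig.solvable hk hcard ihF ih

/-- An admissible rooted graph has an orientation meeting its demands. -/
theorem Admissible.solvable (h : I.Admissible k W z) (hk : 2 ≤ k) : I.Solvable k W := by
  have hsum : 0 ≤ ∑ x ∈ W, I.p x + ∑ x ∈ W, I.q x :=
    add_nonneg (Finset.sum_nonneg fun x _ => h.p_nonneg x)
      (Finset.sum_nonneg fun x _ => h.q_nonneg x)
  obtain ⟨s, hs⟩ := Int.eq_ofNat_of_zero_le hsum
  induction hw : W.card using Nat.strong_induction_on generalizing W z I s with
  | _ w ihW =>
  induction hc : I.F.card using Nat.strong_induction_on generalizing z I s with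
  | _ c ihF =>
  induction s using Nat.strong_induction_on generalizing z I with
  | _ s ihs =>
  have nonneg : ∀ {W z} {J : RootedGraph V}, J.Admissible k W z →
      0 ≤ ∑ x ∈ W, J.p x + ∑ x ∈ W, J.q x := fun h =>
    add_nonneg (Finset.sum_nonneg fun x _ => h.p_nonneg x)
      (Finset.sum_nonneg fun x _ => h.q_nonneg x)
  refine h.solvable_of_smaller hk (fun W' hW' z J hJ => ?_) (fun z J hcard hJ => ?_)
    fun z J hcard hlt hJ => ?_
  · obtain ⟨t, ht⟩ := Int.eq_ofNat_of_zero_le (nonneg hJ)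
    exact ihW _ (hw ▸ hW') hJ (nonneg hJ) t ht rfl
  · obtain ⟨t, ht⟩ := Int.eq_ofNat_of_zero_le (nonneg hJ)
    exact ihF _ (hc ▸ hcard) hJ (nonneg hJ) t ht rfl
  · obtain ⟨t, ht⟩ := Int.eq_ofNat_of_zero_le (nonneg hJ)
    exact ihs t (by omega) hJ (nonneg hJ) ht (hcard.trans hc)

end RootedGraph

end RootedOrientation

namespace Multigraph

open RootedOrientation

variable {V E : Type} [DecidableEq V] (G : Multigraph V E)

/-- The edges of a multigraph as a multiset of pairs of vertices. -/
def edgePairs (s : Finset E) : Multiset (V × V) := s.val.map fun e => (G.fst e, G.snd e)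

/-- The indicator of the endpoints of an edge. -/
def incidence (e : E) (v : V) : ℤ := (if G.fst e = v then 1 else 0) + if G.snd e = v then 1 else 0

theorem exists_orientation_of_mem_divergences {s : Finset E} {β : V → ℤ}
    (h : β ∈ divergences (G.edgePairs s)) :
    ∃ o : E → Bool, ∀ v, β v =
      ∑ e ∈ s, (2 * (if G.tail o e = v then 1 else 0) - G.incidence e v) := by
  classical
  induction s using Finset.induction_on generalizing β with
  | empty =>
    obtain rfl := mem_divergences_zero.1 h
    exact ⟨fun _ => true, by simp⟩
  | insert a s ha ih =>
    rw [edgePairs, Finset.insert_val_of_notMem ha, Multiset.map_cons, mem_divergences_cons] at h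
    obtain ⟨γ, hγ, h⟩ := h
    obtain ⟨o, ho⟩ := ih hγ
    have key : ∀ (b : Bool) (v : V),
        ∑ e ∈ s, (2 * (if G.tail (Function.update o a b) e = v then 1 else 0) -
          G.incidence e v) = γ v := by
      intro b v
      rw [ho]
      refine Finset.sum_congr rfl fun e he => ?_
      have hea : e ≠ a := fun h => ha (h ▸ he)
      have : G.tail (Function.update o a b) e = G.tail o e := by simp [tail, hea]
      rw [this]
    rcases h with rfl | rfl
    · refine ⟨Function.update o a true, fun v => ?_⟩
      rw [Finset.sum_insert ha, key]
      simp only [Pi.add_apply, edgeFlow, Pi.sub_apply, Pi.single_apply, tail, incidence,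
        Function.update_self, if_true, eq_comm (a := v)]
      ring
    · refine ⟨Function.update o a false, fun v => ?_⟩
      rw [Finset.sum_insert ha, key]
      simp only [Pi.add_apply, edgeFlow, Pi.neg_apply, Pi.sub_apply, Pi.single_apply, tail,
        incidence, Function.update_self, Bool.false_eq_true, if_false, eq_comm (a := v)]
      ring

variable [Fintype E]

theorem outDeg_eq_sum (o : E → Bool) (v : V) :
    (G.outDeg o v : ℤ) = ∑ e, if G.tail o e = v then 1 else 0 := by
  have : {e ∈ Set.univ | G.tail o e = v} = ((Finset.univ.filter fun e => G.tail o e = v :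
    Finset E) : Set E) := by ext; simp
  rw [outDeg, outDegOn, this, Set.ncard_coe_finset, Finset.sum_boole]

theorem cut_edgePairs (A : Finset V) :
    cut (G.edgePairs Finset.univ) A = (G.cutEdges A).ncard := by
  have : G.cutEdges A = ((Finset.univ.filter fun e => ¬(G.fst e ∈ A ↔ G.snd e ∈ A) :
      Finset E) : Set E) := by
    ext
    simp only [cutEdges, Set.mem_ofPred_eq, Finset.mem_coe, Finset.mem_filter, Finset.mem_univ]
    tauto
  rw [this, Set.ncard_coe_finset, cut, edgePairs, Multiset.map_map, Finset.natCast_card_filter]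
  refine Finset.sum_congr rfl fun e _ => ?_
  simp [crossing, ite_not]

theorem exists_sum_incidence (A : Finset V) :
    ∃ m, ∑ v ∈ A, ∑ e, G.incidence e v = 2 * m + (G.cutEdges A).ncard := by
  refine ⟨∑ e, if G.fst e ∈ A ∧ G.snd e ∈ A then 1 else 0, ?_⟩
  rw [← cut_edgePairs, Finset.sum_comm, cut, edgePairs, Multiset.map_map, Finset.mul_sum]
  refine Eq.trans ?_ Finset.sum_add_distrib
  refine Finset.sum_congr rfl fun e _ => ?_
  by_cases h1 : G.fst e ∈ A <;> by_cases h2 : G.snd e ∈ A <;>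
    simp [incidence, Finset.sum_add_distrib, crossing, h1, h2]

theorem sum_univ_incidence [Fintype V] :
    ∑ v, ∑ e, G.incidence e v = 2 * Fintype.card E := by
  rw [Finset.sum_comm]
  simp [incidence, Finset.sum_add_distrib, mul_comm]

end Multigraph

/-- Lovász–Thomassen–Wu–Zhang 2013: if `k ≥ 3`, `G` is
`λ'_k`-edge-connected where `λ'_k = 3k - 3` for odd `k` and `λ'_k = 3k - 2`
for even `k`, and `f : V → ZMod k` satisfies `|E(G)| ≡ ∑ v, f v (mod k)`,
then `G` admits an `f`-orientation. -/
theorem lovasz_thomassen_wu_zhang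
    {V E : Type} [Fintype V] [Fintype E] (G : Multigraph V E)
    (k : ℕ) (hk : 3 ≤ k)
    (hconn : G.EdgeConnected (if Odd k then 3 * k - 3 else 3 * k - 2))
    (f : V → ZMod k) (hf : (Nat.card E : ZMod k) = ∑ v, f v) :
    ∃ o : E → Bool, G.IsModOrientation k f o := by
  classical
  have : NeZero k := ⟨by omega⟩
  obtain hV | ⟨⟨z⟩⟩ := isEmpty_or_nonempty V
  · exact ⟨fun _ => true, fun v => hV.elim v⟩
  have hk0 : (0 : ℤ) < k := by omega
  have hfval : ∀ v, (((f v).val : ℤ) : ZMod k) = f v := fun v => by simp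
  let I : RootedOrientation.RootedGraph V := ⟨G.edgePairs Finset.univ, 0, 0,
    fun v => 2 * ((f v).val : ℤ) - ∑ e, G.incidence e v⟩
  have hI : I.Admissible k Finset.univ z := by
    refine ⟨⟨by simp, by simp [I], by simp [I], ?_, ?_⟩, fun A _ hne hA => .inl ?_⟩
    · have hdvd : (k : ℤ) ∣ ∑ v, ((f v).val : ℤ) - Fintype.card E := by
        rw [← ZMod.intCast_zmod_eq_zero_iff_dvd]
        push_cast
        rw [← Nat.card_eq_fintype_card, hf]
        simp
      refine (mul_dvd_mul_left 2 hdvd).trans (Eq.dvd ?_)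
      simp only [RootedOrientation.RootedGraph.demand, I, Finset.sum_sub_distrib,
        G.sum_univ_incidence, ← Finset.mul_sum, Pi.zero_apply, Finset.sum_const_zero]
      ring
    · rintro ⟨o, n, hon, -, ho, hn⟩
      have : I.deg Finset.univ = 0 := by
        rw [RootedOrientation.RootedGraph.deg, RootedOrientation.cut_eq_zero (by simp)]
        simp [I]
      omega
    · obtain ⟨m, hm⟩ := G.exists_sum_incidence A
      have hdeg : I.deg A = (G.cutEdges A).ncard := by
        simp [RootedOrientation.RootedGraph.deg, I, G.cut_edgePairs]
      have hdem : I.demand A = 2 * (∑ v ∈ A, ((f v).val : ℤ) - m) - (G.cutEdges A).ncard := by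
        simp only [RootedOrientation.RootedGraph.demand, I, Finset.sum_sub_distrib, hm,
          ← Finset.mul_sum]
        ring
      rw [hdeg, hdem]
      refine RootedOrientation.splits_of_le hk0 ?_
      have := hconn.2 A (by simpa using hne) (by simpa using hA)
      split_ifs at this <;> omega
  obtain ⟨β, hβ, hβτ⟩ := hI.solvable (by omega)
  obtain ⟨o, ho⟩ := G.exists_orientation_of_mem_divergences hβ
  refine ⟨o, fun v => ?_⟩
  have h := hβτ v (Finset.mem_univ v)
  have h2 : (k : ℤ) ∣ G.outDeg o v - (f v).val := by
    refine (mul_dvd_mul_iff_left two_ne_zero).1 (h.trans (Eq.dvd ?_))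
    rw [ho, G.outDeg_eq_sum, Finset.sum_sub_distrib, ← Finset.mul_sum]
    simp only [I, Pi.zero_apply]
    ring
  rw [← ZMod.intCast_zmod_eq_zero_iff_dvd] at h2
  push_cast at h2
  rw [sub_eq_zero] at h2
  simpa using h2
end
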